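/- Let R₁ ⊆ R₂ be biclosed subsets of Φ⁺. Then R₂ covers R₁ in the extended weak order (i.e., R₁ ⊊ R₂ and there is no biclosed set R' with R₁ ⊊ R' ⊊ R₂) if and only if R₂ \ R₁ consists of exactly one root. -/

import Mathlib

open scoped NNReal

noncomputable section

/-- The ambient vector space `V = ℝ³`. -/
abbrev V : Type := Fin 3 → ℝ

/-- The symmetric bilinear form with `⟨αᵢ,αⱼ⟩ = 1` if `i = j` and `-1` otherwise. -/
def B (x y : V) : ℝ := 2 * (∑ i, x i * y i) - (∑ i, x i) * (∑ i, y i)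

/-- The associated quadratic form. -/
def Q (x : V) : ℝ := B x x

/-- The simple roots `α₁, α₂, α₃` (the standard basis vectors). -/
def α (i : Fin 3) : V := Pi.single i 1

/-- The set of simple roots. -/
def Δ : Set V := Set.range α

/-- `f` is the reflection `r_{αᵢ} : x ↦ x - 2⟨αᵢ,x⟩αᵢ` for some `i` (note `⟨αᵢ,αᵢ⟩ = 1`). -/
def IsSimpleReflection (f : V ≃ₗ[ℝ] V) : Prop :=
  ∃ i : Fin 3, ∀ x : V, f x = x - (2 * B (α i) x) • α i

/-- The group `W ≤ GL(V)` generated by the three simple reflections: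
the standard reflection representation of `U₃`. -/
def W : Subgroup (V ≃ₗ[ℝ] V) := Subgroup.closure {f | IsSimpleReflection f}

/-- The root system `Φ = {w·αᵢ : w ∈ W, i ∈ {1,2,3}}`. -/
def Φ : Set V := {x | ∃ w ∈ W, ∃ i : Fin 3, x = w (α i)}

/-- `Span_{≥0}(X)`: the set of nonnegative linear combinations of elements of `X`. -/
def nnspan (X : Set V) : Set V := (Submodule.span ℝ≥0 X : Set V)

/-- The positive roots `Φ⁺ = Φ ∩ Span_{≥0}(Δ)`. -/
def Φpos : Set V := Φ ∩ nnspan Δ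

/-- `R ⊆ Φ⁺` is closed if for all `a, b ∈ R`, `Span_{≥0}{a,b} ∩ Φ⁺ ⊆ R`. -/
def IsClosedSet (R : Set V) : Prop := ∀ a ∈ R, ∀ b ∈ R, nnspan {a, b} ∩ Φpos ⊆ R

/-- `R` is a biclosed subset of `Φ⁺`. -/
def IsBiclosed (R : Set V) : Prop := R ⊆ Φpos ∧ IsClosedSet R ∧ IsClosedSet (Φpos \ R)

/-- The determinant of two integer vectors. -/
def wedge (p q : ℤ × ℤ) : ℤ := p.1 * q.2 - p.2 * q.1

/-- The polarization of the null vector `(s², (s - t)², t²)` attached to `(s, t)`. -/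
def edgeVec (p q : ℤ × ℤ) : V :=
  ![((p.1 * q.1 : ℤ) : ℝ), (((p.1 - p.2) * (q.1 - q.2) : ℤ) : ℝ), ((p.2 * q.2 : ℤ) : ℝ)]

lemma edgeVec_comm (p q : ℤ × ℤ) : edgeVec p q = edgeVec q p := by
  simp only [edgeVec, mul_comm]

lemma edgeVec_neg_right (p q : ℤ × ℤ) : edgeVec p (-q) = -edgeVec p q := by
  ext i
  fin_cases i <;> simp [edgeVec]
  ring

lemma edgeVec_neg_left (p q : ℤ × ℤ) : edgeVec (-p) q = -edgeVec p q := by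
  rw [edgeVec_comm, edgeVec_neg_right, edgeVec_comm]

lemma edgeVec_add_right (p q r : ℤ × ℤ) : edgeVec p (q + r) = edgeVec p q + edgeVec p r := by
  ext i; fin_cases i <;> simp [edgeVec] <;> ring

lemma edgeVec_add_left (p q r : ℤ × ℤ) : edgeVec (p + q) r = edgeVec p r + edgeVec q r := by
  rw [edgeVec_comm, edgeVec_add_right, edgeVec_comm r p, edgeVec_comm r q]

lemma edgeVec_smul_right (p q : ℤ × ℤ) (k : ℤ) : edgeVec p (k • q) = (k : ℝ) • edgeVec p q := by
  ext i; fin_cases i <;> simp [edgeVec] <;> ring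

lemma edgeVec_smul_left (p q : ℤ × ℤ) (k : ℤ) : edgeVec (k • p) q = (k : ℝ) • edgeVec p q := by
  rw [edgeVec_comm, edgeVec_smul_right, edgeVec_comm]

lemma Q_edgeVec (p q : ℤ × ℤ) : Q (edgeVec p q) = ((wedge p q ^ 2 : ℤ) : ℝ) := by
  simp only [Q, B, edgeVec, wedge, Fin.sum_univ_three]
  simp
  ring

lemma int_mul_pred_nonneg (m : ℤ) : 0 ≤ m * (m - 1) := by
  rcases le_or_gt m 0 with h | h
  · nlinarith
  · exact mul_nonneg h.le (by omega)

lemma mul_mul_nonneg_of_det {a b c d : ℤ} (h : a * d - b * c = 1 ∨ a * d - b * c = -1) :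
    0 ≤ (a * c) * (b * d) := by
  rcases h with h | h
  · have := int_mul_pred_nonneg (a * d)
    have e : b * c = a * d - 1 := by omega
    calc 0 ≤ (a * d) * (a * d - 1) := this
      _ = (a * c) * (b * d) := by rw [← e]; ring
  · have := int_mul_pred_nonneg (b * c)
    have e : a * d = b * c - 1 := by omega
    calc 0 ≤ (b * c) * (b * c - 1) := this
      _ = (a * c) * (b * d) := by rw [← e]; ring

lemma nonneg_or_nonpos_of_mul_nonneg {x y z : ℤ} (hxy : 0 ≤ x * y) (hyz : 0 ≤ y * z)
    (hxz : 0 ≤ x * z) : (0 ≤ x ∧ 0 ≤ y ∧ 0 ≤ z) ∨ (x ≤ 0 ∧ y ≤ 0 ∧ z ≤ 0) := by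
  rcases lt_trichotomy x 0 with hx | hx | hx
  · exact Or.inr ⟨hx.le, by nlinarith, by nlinarith⟩
  · rcases mul_nonneg_iff.mp hyz with h | h
    · exact Or.inl ⟨hx.ge, h⟩
    · exact Or.inr ⟨hx.le, h⟩
  · exact Or.inl ⟨hx.le, by nlinarith, by nlinarith⟩

lemma wedge_coords_sign {p q : ℤ × ℤ} (h : wedge p q = 1 ∨ wedge p q = -1) :
    (0 ≤ p.1 * q.1 ∧ 0 ≤ (p.1 - p.2) * (q.1 - q.2) ∧ 0 ≤ p.2 * q.2) ∨
      (p.1 * q.1 ≤ 0 ∧ (p.1 - p.2) * (q.1 - q.2) ≤ 0 ∧ p.2 * q.2 ≤ 0) := by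
  unfold wedge at h
  apply nonneg_or_nonpos_of_mul_nonneg
  · apply mul_mul_nonneg_of_det
    rcases h with h | h
    · right; linarith
    · left; linarith
  · apply mul_mul_nonneg_of_det
    rcases h with h | h
    · left; linarith
    · right; linarith
  · exact mul_mul_nonneg_of_det h

/-- The reflection in the simple root `αᵢ`. -/
def simpleReflection (i : Fin 3) : V ≃ₗ[ℝ] V :=
  LinearEquiv.ofInvolutive
    { toFun := fun x => x - (2 * B (α i) x) • α i
      map_add' := by
        intro x y
        ext j
        fin_cases i <;> fin_cases j <;>
          simp [B, α, Fin.sum_univ_three, Pi.single_apply] <;> ring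
      map_smul' := by
        intro c x
        ext j
        fin_cases i <;> fin_cases j <;>
          simp [B, α, Fin.sum_univ_three, Pi.single_apply] <;> ring }
    (by
      intro x
      ext j
      fin_cases i <;> fin_cases j <;>
        simp [B, α, Fin.sum_univ_three, Pi.single_apply] <;> ring)

lemma simpleReflection_apply (i : Fin 3) (x : V) :
    simpleReflection i x = x - (2 * B (α i) x) • α i := rfl

lemma simpleReflection_mem (i : Fin 3) : simpleReflection i ∈ W :=
  Subgroup.subset_closure ⟨i, fun _ => rfl⟩

lemma α_mem_Φ (i : Fin 3) : α i ∈ Φ := ⟨1, one_mem _, i, rfl⟩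

lemma map_mem_Φ {w : V ≃ₗ[ℝ] V} (hw : w ∈ W) {x : V} (hx : x ∈ Φ) : w x ∈ Φ := by
  obtain ⟨w', hw', i, rfl⟩ := hx
  exact ⟨w * w', mul_mem hw hw', i, rfl⟩

lemma neg_mem_Φ {x : V} (hx : x ∈ Φ) : -x ∈ Φ := by
  obtain ⟨w, hw, i, rfl⟩ := hx
  have h : simpleReflection i (α i) = -α i := by
    rw [simpleReflection_apply]
    ext j
    fin_cases i <;> fin_cases j <;>
      simp [B, α, Pi.single_apply] <;> norm_num
  rw [← map_neg, ← h]
  exact map_mem_Φ hw (map_mem_Φ (simpleReflection_mem i) (α_mem_Φ i))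

/-- The integral matrix inducing the `i`-th simple reflection. -/
def reflMat : Fin 3 → ℤ × ℤ → ℤ × ℤ
  | 0, p => (p.1 - 2 * p.2, -p.2)
  | 1, p => (p.1, -p.2)
  | 2, p => (-p.1, p.2 - 2 * p.1)

lemma wedge_reflMat (i : Fin 3) (p q : ℤ × ℤ) :
    wedge (reflMat i p) (reflMat i q) = -wedge p q := by
  fin_cases i <;> simp [wedge, reflMat] <;> ring

lemma simple_edgeVec (i : Fin 3) (p q : ℤ × ℤ) :
    edgeVec p q - (2 * B (α i) (edgeVec p q)) • α i = edgeVec (reflMat i p) (reflMat i q) := by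
  ext j
  fin_cases i <;> fin_cases j <;>
    simp [edgeVec, reflMat, B, α, Fin.sum_univ_three, Pi.single_apply] <;> ring

lemma α_eq_edgeVec (i : Fin 3) : ∃ p q : ℤ × ℤ, (wedge p q = 1 ∨ wedge p q = -1) ∧
    α i = edgeVec p q := by
  fin_cases i
  · refine ⟨(1, 0), (1, 1), by simp [wedge], ?_⟩
    ext j; fin_cases j <;> simp [α, edgeVec]
  · refine ⟨(0, 1), (-1, 0), by simp [wedge], ?_⟩
    ext j; fin_cases j <;> simp [α, edgeVec]
  · refine ⟨(1, 1), (0, 1), by simp [wedge], ?_⟩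
    ext j; fin_cases j <;> simp [α, edgeVec]

lemma exists_edgeVec_of_mem_Φ {x : V} (hx : x ∈ Φ) :
    ∃ p q : ℤ × ℤ, (wedge p q = 1 ∨ wedge p q = -1) ∧ x = edgeVec p q := by
  obtain ⟨w, hw, i, rfl⟩ := hx
  have key : ∀ w ∈ W, ∀ x : V,
      (∃ p q : ℤ × ℤ, (wedge p q = 1 ∨ wedge p q = -1) ∧ x = edgeVec p q) →
      ∃ p q : ℤ × ℤ, (wedge p q = 1 ∨ wedge p q = -1) ∧ w x = edgeVec p q := by
    have step : ∀ f : V ≃ₗ[ℝ] V, IsSimpleReflection f → ∀ x : V,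
        (∃ p q : ℤ × ℤ, (wedge p q = 1 ∨ wedge p q = -1) ∧ x = edgeVec p q) →
        ∃ p q : ℤ × ℤ, (wedge p q = 1 ∨ wedge p q = -1) ∧ f x = edgeVec p q := by
      rintro f ⟨i, hf⟩ x ⟨p, q, h, rfl⟩
      refine ⟨reflMat i p, reflMat i q, ?_, by rw [hf, simple_edgeVec]⟩
      rw [wedge_reflMat]; omega
    intro w hw
    induction hw using Subgroup.closure_induction'' with
    | mem f hf => exact step f hf
    | inv_mem f hf =>
      obtain ⟨i, hi⟩ := hf
      have : f⁻¹ = simpleReflection i := by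
        have h1 : f = simpleReflection i := LinearEquiv.ext hi
        rw [h1]
        exact LinearEquiv.ext fun _ => rfl
      rw [this]
      exact step _ ⟨i, fun _ => rfl⟩
    | one => exact fun x hx => hx
    | mul f g _ _ hf hg => exact fun x hx => hf _ (hg _ hx)
  exact key w hw _ (α_eq_edgeVec i)

lemma edgeVec_mem_Φ_of_nonneg (N : ℕ) : ∀ p q : ℤ × ℤ, (wedge p q = 1 ∨ wedge p q = -1) →
    0 ≤ p.1 * q.1 → 0 ≤ (p.1 - p.2) * (q.1 - q.2) → 0 ≤ p.2 * q.2 →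
    p.1 * q.1 + (p.1 - p.2) * (q.1 - q.2) + p.2 * q.2 ≤ N → edgeVec p q ∈ Φ := by
  induction N with
  | zero =>
    intro p q h h0 h1 h2 hN
    exfalso
    have e0 : p.1 * q.1 = 0 := by push_cast at hN; linarith
    have e1 : (p.1 - p.2) * (q.1 - q.2) = 0 := by push_cast at hN; linarith
    have e2 : p.2 * q.2 = 0 := by push_cast at hN; linarith
    have : wedge p q ^ 2 = 0 := by
      have : wedge p q ^ 2 = (p.1 * q.1 + p.2 * q.2 - (p.1 - p.2) * (q.1 - q.2)) ^ 2
          - 4 * (p.1 * q.1) * (p.2 * q.2) := by unfold wedge; ring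
      rw [this, e0, e1, e2]; ring
    rcases h with h | h <;> rw [h] at this <;> norm_num at this
  | succ N ih =>
    intro p q h h0 h1 h2 hN
    have hsq : wedge p q ^ 2 = 1 := by rcases h with h | h <;> rw [h] <;> norm_num
    have hid : p.1 * q.1 * (p.1 * q.1 - (p.1 - p.2) * (q.1 - q.2) - p.2 * q.2)
        + (p.1 - p.2) * (q.1 - q.2) * ((p.1 - p.2) * (q.1 - q.2) - p.1 * q.1 - p.2 * q.2)
        + p.2 * q.2 * (p.2 * q.2 - p.1 * q.1 - (p.1 - p.2) * (q.1 - q.2)) = 1 := by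
      rw [← hsq]; unfold wedge; ring
    have finish : ∀ i : Fin 3, edgeVec (reflMat i p) (reflMat i q) ∈ Φ → edgeVec p q ∈ Φ := by
      intro i hi
      rw [← simple_edgeVec, ← simpleReflection_apply] at hi
      have := map_mem_Φ (simpleReflection_mem i) hi
      have e : simpleReflection i (simpleReflection i (edgeVec p q)) = edgeVec p q :=
        (simpleReflection i).symm_apply_apply _
      rwa [e] at this
    have hw : ∀ i, wedge (reflMat i p) (reflMat i q) = 1 ∨
        wedge (reflMat i p) (reflMat i q) = -1 := by
      intro i; rw [wedge_reflMat]; omega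
    obtain ⟨X, hX⟩ : ∃ X, X = p.1 * q.1 := ⟨_, rfl⟩
    obtain ⟨Y, hY⟩ : ∃ Y, Y = (p.1 - p.2) * (q.1 - q.2) := ⟨_, rfl⟩
    obtain ⟨Z, hZ⟩ : ∃ Z, Z = p.2 * q.2 := ⟨_, rfl⟩
    rw [← hX, ← hY, ← hZ] at hid
    have hdef : edgeVec p q = ![(X : ℝ), Y, Z] := by rw [hX, hY, hZ]; rfl
    have hX0 : (reflMat 0 p).1 * (reflMat 0 q).1 = 2 * Y + 2 * Z - X := by
      simp [reflMat, hX, hY, hZ]; ring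
    have hY0 : ((reflMat 0 p).1 - (reflMat 0 p).2) * ((reflMat 0 q).1 - (reflMat 0 q).2) = Y := by
      simp [reflMat, hY]; ring
    have hZ0 : (reflMat 0 p).2 * (reflMat 0 q).2 = Z := by
      simp [reflMat, hZ]
    have hX1 : (reflMat 1 p).1 * (reflMat 1 q).1 = X := by
      simp [reflMat, hX]
    have hY1 : ((reflMat 1 p).1 - (reflMat 1 p).2) * ((reflMat 1 q).1 - (reflMat 1 q).2) =
        2 * X + 2 * Z - Y := by
      simp [reflMat, hX, hY, hZ]; ring
    have hZ1 : (reflMat 1 p).2 * (reflMat 1 q).2 = Z := by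
      simp [reflMat, hZ]
    have hX2 : (reflMat 2 p).1 * (reflMat 2 q).1 = X := by
      simp [reflMat, hX]
    have hY2 : ((reflMat 2 p).1 - (reflMat 2 p).2) * ((reflMat 2 q).1 - (reflMat 2 q).2) = Y := by
      simp [reflMat, hY]; ring
    have hZ2 : (reflMat 2 p).2 * (reflMat 2 q).2 = 2 * X + 2 * Y - Z := by
      simp [reflMat, hX, hY, hZ]; ring
    rw [← hX] at h0 hN
    rw [← hY] at h1 hN
    rw [← hZ] at h2 hN
    push_cast at hN
    have hcase : (0 < X ∧ 0 < X - Y - Z) ∨ (0 < Y ∧ 0 < Y - X - Z) ∨ (0 < Z ∧ 0 < Z - X - Y) := by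
      by_contra! hc
      obtain ⟨c1, c2, c3⟩ := hc
      have b1 : X * (X - Y - Z) ≤ 0 := by
        rcases h0.eq_or_lt with e | e
        · rw [← e]; simp
        · exact mul_nonpos_of_nonneg_of_nonpos h0 (c1 e)
      have b2 : Y * (Y - X - Z) ≤ 0 := by
        rcases h1.eq_or_lt with e | e
        · rw [← e]; simp
        · exact mul_nonpos_of_nonneg_of_nonpos h1 (c2 e)
      have b3 : Z * (Z - X - Y) ≤ 0 := by
        rcases h2.eq_or_lt with e | e
        · rw [← e]; simp
        · exact mul_nonpos_of_nonneg_of_nonpos h2 (c3 e)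
      linarith
    rcases hcase with ⟨hp, hc⟩ | ⟨hp, hc⟩ | ⟨hp, hc⟩
    · by_cases hz : Y = 0 ∧ Z = 0
      · rw [hz.1, hz.2] at hid
        have : X = 1 := by nlinarith
        rw [hdef, this, hz.1, hz.2]
        convert α_mem_Φ 0 using 1
        ext j; fin_cases j <;> simp [α]
      · apply finish 0
        rcases wedge_coords_sign (hw 0) with ⟨a, b, c⟩ | ⟨a, b, c⟩
        · refine ih _ _ (hw 0) a b c ?_
          rw [hX0, hY0, hZ0]; linarith
        · rw [hY0] at b; rw [hZ0] at c
          exact absurd ⟨le_antisymm b h1, le_antisymm c h2⟩ hz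
    · by_cases hz : X = 0 ∧ Z = 0
      · rw [hz.1, hz.2] at hid
        have : Y = 1 := by nlinarith
        rw [hdef, this, hz.1, hz.2]
        convert α_mem_Φ 1 using 1
        ext j; fin_cases j <;> simp [α]
      · apply finish 1
        rcases wedge_coords_sign (hw 1) with ⟨a, b, c⟩ | ⟨a, b, c⟩
        · refine ih _ _ (hw 1) a b c ?_
          rw [hX1, hY1, hZ1]; linarith
        · rw [hX1] at a; rw [hZ1] at c
          exact absurd ⟨le_antisymm a h0, le_antisymm c h2⟩ hz
    · by_cases hz : X = 0 ∧ Y = 0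
      · rw [hz.1, hz.2] at hid
        have : Z = 1 := by nlinarith
        rw [hdef, this, hz.1, hz.2]
        convert α_mem_Φ 2 using 1
        ext j; fin_cases j <;> simp [α]
      · apply finish 2
        rcases wedge_coords_sign (hw 2) with ⟨a, b, c⟩ | ⟨a, b, c⟩
        · refine ih _ _ (hw 2) a b c ?_
          rw [hX2, hY2, hZ2]; linarith
        · rw [hX2] at a; rw [hY2] at b
          exact absurd ⟨le_antisymm a h0, le_antisymm b h1⟩ hz

lemma edgeVec_mem_Φ {p q : ℤ × ℤ} (h : wedge p q = 1 ∨ wedge p q = -1) : edgeVec p q ∈ Φ := by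
  rcases wedge_coords_sign h with ⟨a, b, c⟩ | ⟨a, b, c⟩
  · exact edgeVec_mem_Φ_of_nonneg _ p q h a b c (Int.self_le_toNat _)
  · have h' : wedge p (-q) = 1 ∨ wedge p (-q) = -1 := by
      simp only [wedge, Prod.fst_neg, Prod.snd_neg] at h ⊢; rcases h with h | h
      · right; linarith
      · left; linarith
    have := edgeVec_mem_Φ_of_nonneg _ p (-q) h' (by simp; linarith) (by simp; linarith)
      (by simp; linarith) (Int.self_le_toNat _)
    rw [edgeVec_neg_right] at this
    simpa using neg_mem_Φ this

lemma exists_wedge_eq_one_of_mem_Φ {x : V} (hx : x ∈ Φ) :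
    ∃ p q : ℤ × ℤ, wedge p q = 1 ∧ x = edgeVec p q := by
  obtain ⟨p, q, h | h, rfl⟩ := exists_edgeVec_of_mem_Φ hx
  · exact ⟨p, q, h, rfl⟩
  · refine ⟨q, p, ?_, edgeVec_comm p q⟩
    unfold wedge at h ⊢; linarith

lemma Q_eq_one_of_mem_Φ {x : V} (hx : x ∈ Φ) : Q x = 1 := by
  obtain ⟨p, q, h, rfl⟩ := exists_wedge_eq_one_of_mem_Φ hx
  rw [Q_edgeVec, h]; norm_num

lemma ne_zero_of_mem_Φ {x : V} (hx : x ∈ Φ) : x ≠ 0 := by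
  rintro rfl
  have := Q_eq_one_of_mem_Φ hx
  simp [Q, B] at this

lemma mem_nnspan_pair {a b x : V} :
    x ∈ nnspan {a, b} ↔ ∃ s t : ℝ, 0 ≤ s ∧ 0 ≤ t ∧ s • a + t • b = x := by
  unfold nnspan
  rw [SetLike.mem_coe, Submodule.mem_span_pair]
  constructor
  · rintro ⟨s, t, rfl⟩
    exact ⟨s, t, s.2, t.2, rfl⟩
  · rintro ⟨s, t, hs, ht, rfl⟩
    exact ⟨⟨s, hs⟩, ⟨t, ht⟩, rfl⟩

lemma mem_nnspan_Δ {x : V} : x ∈ nnspan Δ ↔ ∀ i, 0 ≤ x i := by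
  unfold nnspan Δ
  rw [SetLike.mem_coe]
  constructor
  · intro h
    induction h using Submodule.span_induction with
    | mem y hy =>
      obtain ⟨i, rfl⟩ := hy
      intro j
      unfold α
      rw [Pi.single_apply]
      split_ifs <;> norm_num
    | zero => simp
    | add y z _ _ hy hz => exact fun i => add_nonneg (hy i) (hz i)
    | smul c y _ hy => exact fun i => mul_nonneg c.2 (hy i)
  · intro h
    have : x = ∑ i, (⟨x i, h i⟩ : ℝ≥0) • α i := by
      ext j
      simp [α, Finset.sum_apply, Pi.single_apply]
    rw [this]
    exact Submodule.sum_mem _ fun i _ =>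
      Submodule.smul_mem _ _ (Submodule.subset_span (Set.mem_range_self i))

lemma mem_Φpos {x : V} : x ∈ Φpos ↔ x ∈ Φ ∧ ∀ i, 0 ≤ x i := by
  rw [← mem_nnspan_Δ]; rfl

lemma mem_Φpos_or_neg_mem {x : V} (hx : x ∈ Φ) : x ∈ Φpos ∨ -x ∈ Φpos := by
  obtain ⟨p, q, h, rfl⟩ := exists_wedge_eq_one_of_mem_Φ hx
  rcases wedge_coords_sign (Or.inl h) with ⟨a, b, c⟩ | ⟨a, b, c⟩
  · refine Or.inl (mem_Φpos.mpr ⟨hx, fun i => ?_⟩)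
    fin_cases i
    · exact Int.cast_nonneg a
    · exact Int.cast_nonneg b
    · exact Int.cast_nonneg c
  · refine Or.inr (mem_Φpos.mpr ⟨neg_mem_Φ hx, fun i => ?_⟩)
    rw [Pi.neg_apply, Left.nonneg_neg_iff]
    fin_cases i
    · exact Int.cast_nonpos.mpr a
    · exact Int.cast_nonpos.mpr b
    · exact Int.cast_nonpos.mpr c

lemma neg_notMem_Φpos {x : V} (hx : x ∈ Φpos) : -x ∉ Φpos := by
  intro h
  apply ne_zero_of_mem_Φ (mem_Φpos.mp hx).1
  ext i
  have := (mem_Φpos.mp h).2 i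
  have := (mem_Φpos.mp hx).2 i
  simp at *
  linarith

lemma smul_add_smul_mem_Φpos {a b : V} (ha : a ∈ Φpos) (hb : b ∈ Φpos) {s t : ℝ} (hs : 0 ≤ s)
    (ht : 0 ≤ t) (h : s • a + t • b ∈ Φ) : s • a + t • b ∈ Φpos :=
  mem_Φpos.mpr ⟨h, fun i => add_nonneg (mul_nonneg hs ((mem_Φpos.mp ha).2 i))
    (mul_nonneg ht ((mem_Φpos.mp hb).2 i))⟩

/-- A closed set of roots containing exactly one of each pair of opposite roots. -/
structure IsPositiveSystem (P : Set V) : Prop where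
  subset : P ⊆ Φ
  mem_or_neg_mem : ∀ x ∈ Φ, x ∈ P ∨ -x ∈ P
  neg_notMem : ∀ x ∈ P, -x ∉ P
  smul_add_smul_mem : ∀ a ∈ P, ∀ b ∈ P, ∀ s t : ℝ, 0 ≤ s → 0 ≤ t → s • a + t • b ∈ Φ →
    s • a + t • b ∈ P

namespace IsPositiveSystem

variable {P : Set V}

lemma mem_of_eq (hP : IsPositiveSystem P) {a b x : V} (ha : a ∈ P) (hb : b ∈ P) {s t : ℝ}
    (hs : 0 ≤ s) (ht : 0 ≤ t) (hx : x ∈ Φ) (h : x = s • a + t • b) : x ∈ P :=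
  h ▸ hP.smul_add_smul_mem a ha b hb s t hs ht (h ▸ hx)

lemma notMem_iff (hP : IsPositiveSystem P) {x : V} (hx : x ∈ Φ) : x ∉ P ↔ -x ∈ P :=
  ⟨fun h => (hP.mem_or_neg_mem x hx).resolve_left h,
    fun h h' => hP.neg_notMem x h' h⟩

protected lemma neg (hP : IsPositiveSystem P) : IsPositiveSystem {x | -x ∈ P} where
  subset x hx := by simpa using neg_mem_Φ (hP.subset hx)
  mem_or_neg_mem x hx := by simpa using (hP.mem_or_neg_mem x hx).symm
  neg_notMem x hx := by simpa using hP.neg_notMem _ hx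
  smul_add_smul_mem a ha b hb s t hs ht h :=
    hP.mem_of_eq ha hb hs ht (neg_mem_Φ h) (by module)

end IsPositiveSystem

lemma wedge_cramer {p y y' : ℤ × ℤ} (h : wedge p y = 1 ∨ wedge p y = -1) :
    y' = (wedge p y * wedge p y') • y + (wedge p y * wedge y' y) • p := by
  have hs : wedge p y * wedge p y = 1 := by rcases h with h | h <;> rw [h] <;> norm_num
  unfold wedge at *
  ext
  · simp only [Prod.fst_add, Prod.smul_fst, smul_eq_mul]
    linear_combination (-y'.1) * hs
  · simp only [Prod.snd_add, Prod.smul_snd, smul_eq_mul]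
    linear_combination (-y'.2) * hs

lemma edgeVec_add_smul_mem_Φ {p y : ℤ × ℤ} (h : wedge p y = 1 ∨ wedge p y = -1) (m : ℤ) :
    edgeVec p y + (m : ℝ) • edgeVec p p ∈ Φ := by
  rw [← edgeVec_smul_right, ← edgeVec_add_right]
  apply edgeVec_mem_Φ
  have : wedge p (y + m • p) = wedge p y := by simp [wedge]; ring
  rwa [this]

/-- The roots in `P` eventually contain every `edgeVec p y + m • edgeVec p p`. -/
def EventuallyPos (P : Set V) (p : ℤ × ℤ) : Prop :=
  ∀ y : ℤ × ℤ, (wedge p y = 1 ∨ wedge p y = -1) →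
    ∃ M : ℕ, ∀ m : ℕ, M ≤ m → edgeVec p y + (m : ℝ) • edgeVec p p ∈ P

lemma IsPositiveSystem.eventuallyPos {P : Set V} (hP : IsPositiveSystem P) {p y : ℤ × ℤ}
    (h : wedge p y = 1 ∨ wedge p y = -1) {k : ℝ} (hk : 0 < k) (h1 : edgeVec p y ∈ P)
    (h2 : -edgeVec p y + k • edgeVec p p ∈ P) : EventuallyPos P p := by
  intro y' h'
  have key : ∀ c : ℝ, 0 ≤ c →
      edgeVec p y + c • edgeVec p p = (1 + c / k) • edgeVec p y +
        (c / k) • (-edgeVec p y + k • edgeVec p p) := by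
    intro c _
    match_scalars <;> field_simp
    ring
  have key' : ∀ c : ℝ, 0 ≤ c →
      -edgeVec p y + k • edgeVec p p + c • edgeVec p p = (c / k) • edgeVec p y +
        (1 + c / k) • (-edgeVec p y + k • edgeVec p p) := by
    intro c _
    match_scalars <;> field_simp
    ring
  obtain ⟨j, ε, hε, e⟩ : ∃ j ε : ℤ, (ε = 1 ∨ ε = -1) ∧ y' = ε • y + j • p := by
    refine ⟨_, _, ?_, wedge_cramer h⟩
    rcases h with h | h <;> rcases h' with h' | h' <;> rw [h, h'] <;> norm_num
  have e' : edgeVec p y' = (ε : ℝ) • edgeVec p y + (j : ℝ) • edgeVec p p := by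
    rw [e, edgeVec_add_right, edgeVec_smul_right, edgeVec_smul_right]
  obtain ⟨M, hM⟩ := exists_nat_ge (|(j : ℝ)| + k)
  refine ⟨M, fun m hm => ?_⟩
  have hm' : |(j : ℝ)| + k ≤ m := hM.trans (by exact_mod_cast hm)
  have hj := neg_abs_le (j : ℝ)
  have hmem := edgeVec_add_smul_mem_Φ h' m
  rw [Int.cast_natCast] at hmem
  rcases hε with rfl | rfl
  · have hc : 0 ≤ (j : ℝ) + m := by linarith
    refine hP.mem_of_eq h1 h2 (s := 1 + (j + m) / k) (t := (j + m) / k) (by positivity)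
      (by positivity) hmem ?_
    rw [← key _ hc, e']
    push_cast
    module
  · have hc : 0 ≤ (j : ℝ) + m - k := by linarith
    refine hP.mem_of_eq h1 h2 (s := (j + m - k) / k) (t := 1 + (j + m - k) / k) (by positivity)
      (by positivity) hmem ?_
    rw [← key' _ hc, e']
    push_cast
    module

lemma EventuallyPos.edgeVec_add_mem {P : Set V} (hP : IsPositiveSystem P) {p q : ℤ × ℤ}
    (hp : EventuallyPos P p) (h : wedge p q = 1 ∨ wedge p q = -1) (he : edgeVec p q ∈ P)
    {c : ℤ} (hc : 0 ≤ c) : edgeVec p q + (c : ℝ) • edgeVec p p ∈ P := by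
  obtain ⟨M, hM⟩ := hp (-q) (by
    have : wedge p (-q) = -wedge p q := by simp [wedge]; ring
    rw [this]; omega)
  have hm := hM (M + 1) (by omega)
  have hc' : (0 : ℝ) ≤ c := by exact_mod_cast hc
  rw [edgeVec_neg_right] at hm
  refine hP.mem_of_eq he hm (s := 1 + c / (M + 1)) (t := c / (M + 1)) (by positivity)
    (by positivity) (edgeVec_add_smul_mem_Φ h c) ?_
  push_cast
  match_scalars <;> field_simp
  ring

lemma IsPositiveSystem.edgeVec_combo_mem_aux {P : Set V} (hP : IsPositiveSystem P) (N : ℕ) :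
    ∀ p q : ℤ × ℤ, wedge p q = 1 → EventuallyPos P p → EventuallyPos P q → edgeVec p q ∈ P →
    ∀ a b c d : ℤ, 0 ≤ a → 0 ≤ b → 0 ≤ c → 0 ≤ d → a * d - b * c = 1 → a + b + c + d ≤ N →
      edgeVec (a • p + b • q) (c • p + d • q) ∈ P := by
  induction N with
  | zero =>
    intro p q _ _ _ _ a b c d ha hb hc hd h hN
    have : a = 0 := by push_cast at hN; omega
    have : b = 0 := by push_cast at hN; omega
    subst_vars
    simp at h
  | succ N ih =>
    intro p q hpq hp hq he a b c d ha hb hc hd h hN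
    have hqp : wedge q p = -1 := by unfold wedge at *; linarith
    have e1 : edgeVec p (p + q) = edgeVec p q + ((1 : ℤ) : ℝ) • edgeVec p p := by
      rw [edgeVec_add_right]; simp [add_comm]
    have e2 : edgeVec (p + q) q = edgeVec q p + ((1 : ℤ) : ℝ) • edgeVec q q := by
      rw [edgeVec_add_left, edgeVec_comm q p]; simp
    have m1 : edgeVec p (p + q) ∈ P := e1 ▸ hp.edgeVec_add_mem hP (Or.inl hpq) he zero_le_one
    have m2 : edgeVec (p + q) q ∈ P := e2 ▸ hq.edgeVec_add_mem hP (Or.inr hqp)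
      (edgeVec_comm p q ▸ he) zero_le_one
    have w1 : wedge p (p + q) = 1 := by unfold wedge at *; simp; linarith
    have w2 : wedge (p + q) q = 1 := by unfold wedge at *; simp; linarith
    have hpq' : EventuallyPos P (p + q) := by
      refine hP.eventuallyPos (Or.inl w2) zero_lt_one m2 ?_
      have : -edgeVec (p + q) q + (1 : ℝ) • edgeVec (p + q) (p + q) = edgeVec p (p + q) := by
        rw [edgeVec_add_right (p + q) p q, edgeVec_comm p (p + q)]; module
      rwa [this]
    rcases hb.eq_or_lt with rfl | hb'
    · obtain ⟨rfl, rfl⟩ : a = 1 ∧ d = 1 := by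
        rw [zero_mul, sub_zero] at h
        exact ⟨Int.eq_one_of_mul_eq_one_right ha h, Int.eq_one_of_mul_eq_one_left hd h⟩
      have := hp.edgeVec_add_mem hP (Or.inl hpq) he hc
      rw [← edgeVec_smul_right, ← edgeVec_add_right] at this
      simpa [add_comm] using this
    rcases hc.eq_or_lt with rfl | hc'
    · obtain ⟨rfl, rfl⟩ : a = 1 ∧ d = 1 := by
        rw [mul_zero, sub_zero] at h
        exact ⟨Int.eq_one_of_mul_eq_one_right ha h, Int.eq_one_of_mul_eq_one_left hd h⟩
      have := hq.edgeVec_add_mem hP (Or.inr hqp) (edgeVec_comm p q ▸ he) hb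
      rw [← edgeVec_smul_right, ← edgeVec_add_right, edgeVec_comm] at this
      simpa [add_comm] using this
    push_cast at hN
    rcases le_total b a with hab | hab
    · rcases le_or_gt d c with hcd | hcd
      · have := ih p (p + q) w1 hp hpq' m1 (a - b) b (c - d) d (by omega) hb (by omega) hd
          (by linarith) (by omega)
        convert this using 2 <;> module
      · have := ih (p + q) q w2 hpq' hq m2 a (b - a) c (d - c) ha (by nlinarith) hc (by omega)
          (by linarith) (by nlinarith)
        convert this using 2 <;> module
    · have hcd : c ≤ d := by
        by_contra hcd
        nlinarith
      have := ih (p + q) q w2 hpq' hq m2 a (b - a) c (d - c) ha (by omega) hc (by omega)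
          (by linarith) (by nlinarith)
      convert this using 2 <;> module

lemma IsPositiveSystem.edgeVec_combo_mem {P : Set V} (hP : IsPositiveSystem P) {p q : ℤ × ℤ}
    (hpq : wedge p q = 1) (hp : EventuallyPos P p) (hq : EventuallyPos P q)
    (he : edgeVec p q ∈ P) {a b c d : ℤ} (ha : 0 ≤ a) (hb : 0 ≤ b) (hc : 0 ≤ c) (hd : 0 ≤ d)
    (h : a * d - b * c = 1) : edgeVec (a • p + b • q) (c • p + d • q) ∈ P :=
  hP.edgeVec_combo_mem_aux _ p q hpq hp hq he a b c d ha hb hc hd h (Int.self_le_toNat _)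

/-- The linear functional sending `edgeVec z w` to the polarization of
`(x ∧ z) * (z ∧ y)`. -/
def crossForm (x y : ℝ × ℝ) : V →ₗ[ℝ] ℝ where
  toFun X := -(x.2 * y.2) * X 0 - x.1 * y.1 * X 2 +
    (x.1 * y.2 + x.2 * y.1) * (X 0 + X 2 - X 1) / 2
  map_add' X Y := by simp only [Pi.add_apply]; ring
  map_smul' c X := by simp only [Pi.smul_apply, smul_eq_mul, RingHom.id_apply]; ring

/-- The determinant of two real vectors. -/
def realWedge (x y : ℝ × ℝ) : ℝ := x.1 * y.2 - x.2 * y.1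

/-- The inclusion of integer vectors into real vectors. -/
def toReal (p : ℤ × ℤ) : ℝ × ℝ := (p.1, p.2)

lemma realWedge_toReal (p q : ℤ × ℤ) : realWedge (toReal p) (toReal q) = wedge p q := by
  simp [realWedge, toReal, wedge]

lemma crossForm_edgeVec (x y : ℝ × ℝ) (z w : ℤ × ℤ) : crossForm x y (edgeVec z w) =
    (realWedge x (toReal z) * realWedge (toReal w) y +
      realWedge x (toReal w) * realWedge (toReal z) y) / 2 := by
  simp [crossForm, edgeVec, realWedge, toReal]
  ring

lemma EventuallyPos.neg {P : Set V} {p : ℤ × ℤ} (hp : EventuallyPos P p) :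
    EventuallyPos P (-p) := by
  intro y hy
  obtain ⟨M, hM⟩ := hp (-y) (by simpa [wedge] using hy)
  refine ⟨M, fun m hm => ?_⟩
  simpa [edgeVec_neg_left, edgeVec_neg_right] using hM m hm

lemma eq_smul_add_smul_of_wedge {p q : ℤ × ℤ} (h : wedge p q = 1) (z : ℤ × ℤ) :
    z = wedge z q • p + wedge p z • q := by
  unfold wedge at *
  ext
  · simp only [Prod.fst_add, Prod.smul_fst, smul_eq_mul]
    linear_combination (-z.1) * h
  · simp only [Prod.snd_add, Prod.smul_snd, smul_eq_mul]
    linear_combination (-z.2) * h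

lemma wedge_coords {p q : ℤ × ℤ} (h : wedge p q = 1) (z w : ℤ × ℤ) :
    wedge z q * wedge p w - wedge p z * wedge w q = wedge z w := by
  unfold wedge at *
  linear_combination (z.1 * w.2 - z.2 * w.1) * h

/-- The triangle spanned by `p`, `p + q`, `q` is a source if all its sides, oriented
cyclically, are in `P`. -/
def IsSource (P : Set V) (p q : ℤ × ℤ) : Prop :=
  wedge p q = 1 ∧ edgeVec p q ∉ P ∧ edgeVec p (p + q) ∈ P ∧ edgeVec (p + q) q ∈ P

lemma IsSource.edgeVec_mem {P : Set V} (hP : IsPositiveSystem P) {p q : ℤ × ℤ}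
    (h : IsSource P p q) {a b c d : ℤ} (h1 : a * d - b * c = 1 ∨ a * d - b * c = -1)
    (hac : 0 ≤ a * c) (hbd : 0 ≤ b * d) (habcd : 0 ≤ (a - b) * (c - d)) :
    edgeVec (a • p + b • q) (c • p + d • q) ∈ P := by
  wlog hdet : a * d - b * c = 1 generalizing a b c d
  · rw [edgeVec_comm]
    have hdet' : c * b - d * a = 1 := by
      rcases h1 with h1 | h1
      · exact absurd h1 hdet
      · linarith
    exact this (Or.inl hdet') (by linarith) (by linarith) (by linarith) hdet'
  wlog hpos : 0 ≤ a ∧ 0 ≤ c generalizing a b c d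
  · have := this (a := -a) (b := -b) (c := -c) (d := -d) (by left; linarith) (by linarith)
      (by linarith) (by linarith) (by linarith) (by
        rcases mul_nonneg_iff.mp hac with h | h
        · exact absurd h hpos
        · omega)
    rw [show (-a) • p + (-b) • q = -(a • p + b • q) by module,
      show (-c) • p + (-d) • q = -(c • p + d • q) by module, edgeVec_neg_left,
      edgeVec_neg_right, neg_neg] at this
    exact this
  clear h1
  obtain ⟨hpq, he, hpm, hmq⟩ := h
  obtain ⟨ha, hc⟩ := hpos
  have he' : -edgeVec p q ∈ P := (hP.notMem_iff (edgeVec_mem_Φ (Or.inl hpq))).mp he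
  have wqp : wedge q (-p) = 1 := by simpa [wedge, mul_comm, neg_add_eq_sub] using hpq
  have wpq : wedge p (-q) = -1 := by unfold wedge at *; simp; linarith
  have w1 : wedge p (p + q) = 1 := by unfold wedge at *; simp; linarith
  have w2 : wedge (p + q) q = 1 := by unfold wedge at *; simp; linarith
  have hp : EventuallyPos P p := by
    refine hP.eventuallyPos (y := -q) (Or.inr wpq) zero_lt_one (edgeVec_neg_right p q ▸ he') ?_
    rw [edgeVec_neg_right, neg_neg, one_smul, add_comm, ← edgeVec_add_right]
    exact hpm
  have hq : EventuallyPos P q := by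
    refine hP.eventuallyPos (y := -p) (Or.inl wqp) zero_lt_one ?_ ?_
    · rwa [edgeVec_neg_right, edgeVec_comm]
    · rw [edgeVec_neg_right, neg_neg, one_smul, ← edgeVec_add_right, edgeVec_comm]
      exact hmq
  have hm : EventuallyPos P (p + q) := by
    refine hP.eventuallyPos (Or.inl w2) zero_lt_one hmq ?_
    have : -edgeVec (p + q) q + (1 : ℝ) • edgeVec (p + q) (p + q) = edgeVec p (p + q) := by
      rw [edgeVec_add_right (p + q) p q, edgeVec_comm p (p + q)]; module
    rwa [this]
  rcases mul_nonneg_iff.mp hbd with ⟨hb, hd⟩ | ⟨hb, hd⟩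
  · rcases mul_nonneg_iff.mp habcd with ⟨hab, hcd⟩ | ⟨hab, hcd⟩
    · have := hP.edgeVec_combo_mem w1 hp hm hpm hab hb hcd hd (by linarith)
      convert this using 2 <;> module
    · have := hP.edgeVec_combo_mem w2 hm hq hmq (a := a) (b := b - a) (c := c) (d := d - c)
        ha (by linarith) hc (by linarith) (by linarith)
      convert this using 2 <;> module
  · have := hP.edgeVec_combo_mem wqp hq hp.neg (by rwa [edgeVec_neg_right, edgeVec_comm])
      (a := -b) (b := a) (c := -d) (d := c) (by linarith) ha (by linarith) hc (by linarith)
    rw [show (-b) • q + a • -p = -(a • p + b • q) by module,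
      show (-d) • q + c • -p = -(c • p + d • q) by module, edgeVec_neg_left,
      edgeVec_neg_right, neg_neg] at this
    exact this

lemma IsSource.exists_functional {P : Set V} (hP : IsPositiveSystem P) {p q : ℤ × ℤ}
    (h : IsSource P p q) : ∃ f : V →ₗ[ℝ] ℝ, f ≠ 0 ∧ ∀ x ∈ P, 0 ≤ f x := by
  have hpq := h.1
  obtain ⟨f, hf⟩ : ∃ f : V →ₗ[ℝ] ℝ, ∀ z w : ℤ × ℤ, f (edgeVec z w) =
      ((wedge z q * wedge w q + wedge p z * wedge p w +
        (wedge z q - wedge p z) * (wedge w q - wedge p w) : ℤ) : ℝ) := by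
    refine ⟨(-2 : ℝ) • crossForm (toReal q) (toReal q) +
      (-2 : ℝ) • crossForm (toReal p) (toReal p) + (-2 : ℝ) • crossForm (toReal p) (toReal q),
      fun z w => ?_⟩
    simp only [LinearMap.add_apply, LinearMap.smul_apply, crossForm_edgeVec, realWedge_toReal]
    have e : ∀ x y : ℤ × ℤ, wedge x y = -wedge y x := fun x y => by unfold wedge; ring
    rw [e q z, e q w, e z p, e w p]
    simp only [smul_eq_mul]
    push_cast
    ring
  refine ⟨f, fun h0 => ?_, fun x hx => ?_⟩
  · have := hf p p
    rw [h0, hpq] at this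
    simp [wedge, mul_comm] at this
  · obtain ⟨z, w, hzw, rfl⟩ := exists_wedge_eq_one_of_mem_Φ (hP.subset hx)
    have hdet := wedge_coords hpq z w
    rw [hzw] at hdet
    rw [hf]
    rcases wedge_coords_sign (p := (wedge z q, wedge p z)) (q := (wedge w q, wedge p w))
      (Or.inl hdet) with ⟨h1, h2, h3⟩ | ⟨h1, h2, h3⟩
    · simp only at h1 h2 h3
      exact_mod_cast (by linarith)
    · exfalso
      simp only at h1 h2 h3
      have := h.edgeVec_mem hP (a := wedge z q) (b := wedge p z) (c := -wedge w q)
        (d := -wedge p w) (by right; linarith) (by linarith) (by linarith) (by linarith)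
      rw [← eq_smul_add_smul_of_wedge hpq, show (-wedge w q) • p + (-wedge p w) • q =
        -(wedge w q • p + wedge p w • q) by module, ← eq_smul_add_smul_of_wedge hpq,
        edgeVec_neg_right] at this
      exact hP.neg_notMem _ hx this

/-- The vertices of the `n`-th level of the Farey subdivision of the circle, enumerated
counterclockwise. -/
def fareyVertex : ℕ → ℤ → ℤ × ℤ
  | 0, i => if i % 4 = 0 then (1, 0) else if i % 4 = 1 then (0, 1) else
      if i % 4 = 2 then (-1, 0) else (0, -1)
  | n + 1, i => if i % 2 = 0 then fareyVertex n (i / 2) else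
      fareyVertex n (i / 2) + fareyVertex n (i / 2 + 1)

lemma fareyVertex_two_mul (n : ℕ) (i : ℤ) : fareyVertex (n + 1) (2 * i) = fareyVertex n i := by
  rw [fareyVertex, if_pos (by omega)]
  congr 1
  omega

lemma fareyVertex_two_mul_add_one (n : ℕ) (i : ℤ) :
    fareyVertex (n + 1) (2 * i + 1) = fareyVertex n i + fareyVertex n (i + 1) := by
  rw [fareyVertex, if_neg (by omega), show (2 * i + 1) / 2 = i by omega]

lemma fareyVertex_zero_cases (i : ℤ) :
    (fareyVertex 0 i = (1, 0) ∧ fareyVertex 0 (i + 1) = (0, 1) ∧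
      fareyVertex 0 (i + 2) = (-1, 0)) ∨
    (fareyVertex 0 i = (0, 1) ∧ fareyVertex 0 (i + 1) = (-1, 0) ∧
      fareyVertex 0 (i + 2) = (0, -1)) ∨
    (fareyVertex 0 i = (-1, 0) ∧ fareyVertex 0 (i + 1) = (0, -1) ∧
      fareyVertex 0 (i + 2) = (1, 0)) ∨
    (fareyVertex 0 i = (0, -1) ∧ fareyVertex 0 (i + 1) = (1, 0) ∧
      fareyVertex 0 (i + 2) = (0, 1)) := by
  have h : i % 4 = 0 ∨ i % 4 = 1 ∨ i % 4 = 2 ∨ i % 4 = 3 := by omega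
  rcases h with h | h | h | h <;> simp [fareyVertex, Int.add_emod, h]

lemma fareyVertex_add_half (n : ℕ) (i : ℤ) :
    fareyVertex n (i + 2 ^ (n + 1)) = -fareyVertex n i := by
  induction n generalizing i with
  | zero =>
    rcases fareyVertex_zero_cases i with h | h | h | h <;> norm_num [h]
  | succ n ih =>
    obtain ⟨k, rfl | rfl⟩ := Int.even_or_odd' i
    · rw [show 2 * k + 2 ^ (n + 1 + 1) = 2 * (k + 2 ^ (n + 1)) by ring, fareyVertex_two_mul,
        fareyVertex_two_mul, ih]
    · rw [show 2 * k + 1 + 2 ^ (n + 1 + 1) = 2 * (k + 2 ^ (n + 1)) + 1 by ring,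
        fareyVertex_two_mul_add_one, fareyVertex_two_mul_add_one, ih,
        show k + 2 ^ (n + 1) + 1 = k + 1 + 2 ^ (n + 1) by ring, ih, neg_add]

lemma wedge_add_left (p q r : ℤ × ℤ) : wedge (p + q) r = wedge p r + wedge q r := by
  simp [wedge]; ring

lemma wedge_add_right (p q r : ℤ × ℤ) : wedge p (q + r) = wedge p q + wedge p r := by
  simp [wedge]; ring

lemma wedge_neg_left (p q : ℤ × ℤ) : wedge (-p) q = -wedge p q := by
  simp [wedge]; ring

lemma wedge_neg_right (p q : ℤ × ℤ) : wedge p (-q) = -wedge p q := by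
  simp [wedge]; ring

lemma wedge_self (p : ℤ × ℤ) : wedge p p = 0 := by
  simp [wedge]; ring

lemma wedge_swap (p q : ℤ × ℤ) : wedge q p = -wedge p q := by
  simp [wedge]; ring

lemma wedge_fareyVertex_succ (n : ℕ) (i : ℤ) :
    wedge (fareyVertex n i) (fareyVertex n (i + 1)) = 1 := by
  induction n generalizing i with
  | zero =>
    rcases fareyVertex_zero_cases i with h | h | h | h <;> simp [h, wedge]
  | succ n ih =>
    obtain ⟨k, rfl | rfl⟩ := Int.even_or_odd' i
    · rw [fareyVertex_two_mul, fareyVertex_two_mul_add_one, wedge_add_right, wedge_self, ih,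
        zero_add]
    · rw [fareyVertex_two_mul_add_one, show 2 * k + 1 + 1 = 2 * (k + 1) by ring,
        fareyVertex_two_mul, wedge_add_left, wedge_self, ih, add_zero]

lemma wedge_fareyVertex_nonneg (n : ℕ) {i j : ℤ} (hij : i ≤ j) (hji : j ≤ i + 2 ^ (n + 1)) :
    0 ≤ wedge (fareyVertex n i) (fareyVertex n j) := by
  induction n generalizing i j with
  | zero =>
    have : j = i ∨ j = i + 1 ∨ j = i + 2 := by norm_num at hji; omega
    rcases this with rfl | rfl | rfl
    · rw [wedge_self]
    · rw [wedge_fareyVertex_succ]; norm_num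
    · rcases fareyVertex_zero_cases i with h | h | h | h <;> simp [h, wedge]
  | succ n ih =>
    rw [pow_succ] at hji
    obtain ⟨k, rfl | rfl⟩ := Int.even_or_odd' i <;> obtain ⟨l, rfl | rfl⟩ := Int.even_or_odd' j
    · rw [fareyVertex_two_mul, fareyVertex_two_mul]
      exact ih (by omega) (by omega)
    · rw [fareyVertex_two_mul, fareyVertex_two_mul_add_one, wedge_add_right]
      exact add_nonneg (ih (by omega) (by omega)) (ih (by omega) (by omega))
    · rw [fareyVertex_two_mul, fareyVertex_two_mul_add_one, wedge_add_left]
      exact add_nonneg (ih (by omega) (by omega)) (ih (by omega) (by omega))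
    · rcases eq_or_ne k l with rfl | hkl
      · rw [wedge_self]
      rcases eq_or_ne l (k + 2 ^ (n + 1)) with rfl | hlk
      · rw [fareyVertex_two_mul_add_one, fareyVertex_two_mul_add_one, fareyVertex_add_half,
          show k + 2 ^ (n + 1) + 1 = k + 1 + 2 ^ (n + 1) by ring, fareyVertex_add_half, ← neg_add,
          wedge_neg_right, wedge_self, neg_zero]
      rw [fareyVertex_two_mul_add_one, fareyVertex_two_mul_add_one, wedge_add_left,
        wedge_add_right, wedge_add_right]
      have := ih (i := k) (j := l) (by omega) (by omega)
      have := ih (i := k) (j := l + 1) (by omega) (by omega)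
      have := ih (i := k + 1) (j := l) (by omega) (by omega)
      have := ih (i := k + 1) (j := l + 1) (by omega) (by omega)
      linarith

lemma fareyVertex_add_pow_mul (n m : ℕ) (i : ℤ) :
    fareyVertex (n + m) (2 ^ m * i) = fareyVertex n i := by
  induction m with
  | zero => simp
  | succ m ih => rw [← add_assoc, pow_succ', mul_assoc, fareyVertex_two_mul, ih]

lemma exists_fareyVertex_edge (N : ℕ) : ∀ p q : ℤ × ℤ, wedge p q = 1 →
    0 ≤ p.1 * q.1 + p.2 * q.2 → p.1 * q.1 + p.2 * q.2 ≤ N →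
    ∃ (n : ℕ) (i : ℤ), fareyVertex n i = p ∧ fareyVertex n (i + 1) = q := by
  induction N using Nat.strong_induction_on with
  | _ N ih =>
    rintro ⟨a, b⟩ ⟨c, d⟩ h h0 hN
    simp only at h0 hN
    have h' : a * d - b * c = 1 := h
    have hid : (a * a + b * b) * (c * c + d * d) = (a * c + b * d) ^ 2 + 1 := by
      linear_combination (a * d - b * c + 1) * h'
    have hp : 0 < a * a + b * b := by
      by_contra hcon
      have : a * a = 0 := le_antisymm (by nlinarith [mul_self_nonneg b]) (mul_self_nonneg a)
      have : b * b = 0 := le_antisymm (by nlinarith [mul_self_nonneg a]) (mul_self_nonneg b)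
      nlinarith
    have hq : 0 < c * c + d * d := by
      by_contra hcon
      have : c * c = 0 := le_antisymm (by nlinarith [mul_self_nonneg d]) (mul_self_nonneg c)
      have : d * d = 0 := le_antisymm (by nlinarith [mul_self_nonneg c]) (mul_self_nonneg d)
      nlinarith
    rcases h0.eq_or_lt with hz | hpos
    · rw [← hz] at hid
      have hp1 : a * a + b * b = 1 := Int.eq_one_of_mul_eq_one_right hp.le
        (by linarith : _ * (c * c + d * d) = 1)
      have hc : c = -b := by linear_combination (-c) * hp1 + (-a) * hz - b * h'
      have hd : d = a := by linear_combination (-d) * hp1 + (-b) * hz + a * h'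
      subst hc hd
      have ha1 : d ≤ 1 := by nlinarith [mul_self_nonneg b]
      have ha2 : -1 ≤ d := by nlinarith [mul_self_nonneg b]
      have : (d = 0 ∧ (b = 1 ∨ b = -1)) ∨ (d = 1 ∧ b = 0) ∨ (d = -1 ∧ b = 0) := by
        have hb1 : b ≤ 1 := by nlinarith [mul_self_nonneg d]
        have hb2 : -1 ≤ b := by nlinarith [mul_self_nonneg d]
        interval_cases d <;> interval_cases b <;> omega
      rcases this with ⟨rfl, rfl | rfl⟩ | ⟨rfl, rfl⟩ | ⟨rfl, rfl⟩
      · exact ⟨0, 1, by decide, by decide⟩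
      · exact ⟨0, 3, by decide, by decide⟩
      · exact ⟨0, 0, by decide, by decide⟩
      · exact ⟨0, 2, by decide, by decide⟩
    · by_cases hpq : a * a + b * b ≤ a * c + b * d
      · obtain ⟨n, i, h1, h2⟩ := ih (a * c + b * d - (a * a + b * b)).toNat (by omega) (a, b)
          (c - a, d - b) (by simp only [wedge]; linarith) (by simp only; linarith)
          (by rw [Int.toNat_of_nonneg (by linarith)]; simp only; linarith)
        refine ⟨n + 1, 2 * i, by rw [fareyVertex_two_mul, h1], ?_⟩
        rw [fareyVertex_two_mul_add_one, h1, h2]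
        simp
      · have hqp : c * c + d * d ≤ a * c + b * d := by nlinarith
        obtain ⟨n, i, h1, h2⟩ := ih (a * c + b * d - (c * c + d * d)).toNat (by omega)
          (a - c, b - d) (c, d) (by simp only [wedge]; linarith) (by simp only; linarith)
          (by rw [Int.toNat_of_nonneg (by linarith)]; simp only; linarith)
        refine ⟨n + 1, 2 * i + 1, ?_, ?_⟩
        · rw [fareyVertex_two_mul_add_one, h1, h2]
          simp
        · rw [show 2 * i + 1 + 1 = 2 * (i + 1) by ring, fareyVertex_two_mul, h2]

lemma exists_fareyVertex_eq {p q : ℤ × ℤ} (h : wedge p q = 1) :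
    ∃ (n : ℕ) (i : ℤ), fareyVertex n i = p := by
  rcases le_total 0 (p.1 * q.1 + p.2 * q.2) with h0 | h0
  · obtain ⟨n, i, h1, -⟩ := exists_fareyVertex_edge _ p q h h0 (Int.self_le_toNat _)
    exact ⟨n, i, h1⟩
  · obtain ⟨n, i, -, h2⟩ := exists_fareyVertex_edge _ q (-p)
      (by rw [wedge_neg_right, wedge_swap, neg_neg, h])
      (by simp only [Prod.fst_neg, Prod.snd_neg]; linarith) (Int.self_le_toNat _)
    exact ⟨n, i + 1 + 2 ^ (n + 1), by rw [fareyVertex_add_half, h2, neg_neg]⟩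

/-- The set of `i` satisfying `S` is, modulo the period `K`, the nonempty proper interval
`[A, B)`. -/
structure IsCut (S : ℤ → Prop) (K A B : ℤ) : Prop where
  lt : A < B
  lt_add : B < A + K
  pos : ∀ i, A ≤ i → i < B → S i
  neg : ∀ i, B ≤ i → i < A + K → ¬S i

lemma exists_isCut_refinement {S T : ℤ → Prop} {K : ℤ} (hS : ∀ i, S (i + K) ↔ S i)
    (hT : ∀ i, T (i + 2 * K) ↔ T i)
    (pp : ∀ i, S (i - 1) → S i → T (2 * i - 1) ∧ T (2 * i))
    (nn : ∀ i, ¬S (i - 1) → ¬S i → ¬T (2 * i - 1) ∧ ¬T (2 * i))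
    (np : ∀ i, ¬S (i - 1) → S i → T (2 * i - 1) → T (2 * i))
    (pn : ∀ i, S (i - 1) → ¬S i → T (2 * i) → T (2 * i - 1))
    (source : ∀ i, ¬S i → ¬(T (2 * i) ∧ T (2 * i + 1)))
    (sink : ∀ i, S i → T (2 * i) ∨ T (2 * i + 1))
    {A B : ℤ} (h : IsCut S K A B) : ∃ A' B', IsCut T (2 * K) A' B' := by
  obtain ⟨hAB, hBA, hpos, hneg⟩ := h
  have hA : S A := hpos A le_rfl hAB
  have hA' : ¬S (A - 1) := fun h => hneg (A - 1 + K) (by omega) (by omega) ((hS _).mpr h)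
  have hB : ¬S B := hneg B le_rfl hBA
  have hB' : S (B - 1) := hpos _ (by omega) (by omega)
  have hTpos : ∀ j, 2 * A + 1 ≤ j → j ≤ 2 * B - 2 → T j := by
    intro j h1 h2
    obtain ⟨k, rfl | rfl⟩ := Int.even_or_odd' j
    · exact (pp k (hpos _ (by omega) (by omega)) (hpos _ (by omega) (by omega))).2
    · have := (pp (k + 1) (hpos _ (by omega) (by omega)) (hpos _ (by omega) (by omega))).1
      rwa [show 2 * (k + 1) - 1 = 2 * k + 1 by ring] at this
  have hTneg : ∀ j, 2 * B + 1 ≤ j → j ≤ 2 * (A + K) - 2 → ¬T j := by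
    intro j h1 h2
    obtain ⟨k, rfl | rfl⟩ := Int.even_or_odd' j
    · exact (nn k (hneg _ (by omega) (by omega)) (hneg _ (by omega) (by omega))).2
    · have := (nn (k + 1) (hneg _ (by omega) (by omega)) (hneg _ (by omega) (by omega))).1
      rwa [show 2 * (k + 1) - 1 = 2 * k + 1 by ring] at this
  have sA := sink A hA
  have sB := source B hB
  have tA := np A hA' hA
  have tB := pn B hB' hB
  have per1 := hT (2 * A - 1)
  have per2 := hT (2 * A)
  obtain ⟨A', hA'1, hA'2, hA'3, hA'4⟩ : ∃ A', 2 * A - 1 ≤ A' ∧ A' ≤ 2 * A + 1 ∧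
      (∀ j, A' ≤ j → j ≤ 2 * A → T j) ∧ ∀ j, 2 * A - 1 ≤ j → j < A' → ¬T j := by
    by_cases h1 : T (2 * A)
    · by_cases h2 : T (2 * A - 1)
      · refine ⟨2 * A - 1, by omega, by omega, fun j h3 h4 => ?_, fun j h3 h4 => by omega⟩
        obtain rfl | rfl : j = 2 * A - 1 ∨ j = 2 * A := by omega
        exacts [h2, h1]
      · refine ⟨2 * A, by omega, by omega, fun j h3 h4 => ?_, fun j h3 h4 => ?_⟩
        · rwa [le_antisymm h4 h3]
        · rwa [show j = 2 * A - 1 by omega]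
    · refine ⟨2 * A + 1, by omega, by omega, fun j h3 h4 => by omega, fun j h3 h4 => ?_⟩
      obtain rfl | rfl : j = 2 * A - 1 ∨ j = 2 * A := by omega
      exacts [fun h => h1 (tA h), h1]
  obtain ⟨B', hB'1, hB'2, hB'3, hB'4⟩ : ∃ B', 2 * B - 1 ≤ B' ∧ B' ≤ 2 * B + 1 ∧
      (∀ j, B' ≤ j → j ≤ 2 * B → ¬T j) ∧ ∀ j, 2 * B - 1 ≤ j → j < B' → T j := by
    by_cases h1 : T (2 * B)
    · refine ⟨2 * B + 1, by omega, by omega, fun j h3 h4 => by omega, fun j h3 h4 => ?_⟩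
      obtain rfl | rfl : j = 2 * B - 1 ∨ j = 2 * B := by omega
      exacts [tB h1, h1]
    · by_cases h2 : T (2 * B - 1)
      · refine ⟨2 * B, by omega, by omega, fun j h3 h4 => ?_, fun j h3 h4 => ?_⟩
        · rwa [le_antisymm h4 h3]
        · rwa [show j = 2 * B - 1 by omega]
      · refine ⟨2 * B - 1, by omega, by omega, fun j h3 h4 => ?_, fun j h3 h4 => by omega⟩
        obtain rfl | rfl : j = 2 * B - 1 ∨ j = 2 * B := by omega
        exacts [h2, h1]
  refine ⟨A', B', ?_, ?_, fun j h1 h2 => ?_, fun j h1 h2 => ?_⟩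
  · by_contra hcon
    have e1 : A' = 2 * A + 1 := by omega
    have e2 : 2 * B - 1 = 2 * A + 1 := by omega
    rcases sA with h | h
    · exact hA'4 _ (by omega) (by omega) h
    · exact hB'3 (2 * A + 1) (by omega) (by omega) h
  · by_contra hcon
    have e1 : A' = 2 * A - 1 := by omega
    have e2 : 2 * B + 1 = 2 * A - 1 + 2 * K := by omega
    refine sB ⟨hB'4 _ (by omega) (by omega), ?_⟩
    rw [e2, per1]
    exact hA'3 _ (by omega) (by omega)
  · rcases le_or_gt j (2 * A) with h3 | h3
    · exact hA'3 j h1 h3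
    rcases le_or_gt (2 * B - 1) j with h4 | h4
    · exact hB'4 j h4 h2
    exact hTpos j (by omega) (by omega)
  · rcases le_or_gt j (2 * B) with h3 | h3
    · exact hB'3 j h1 h3
    rcases le_or_gt (2 * A - 1 + 2 * K) j with h4 | h4
    · have := hA'4 (j - 2 * K) (by omega) (by omega)
      rwa [← hT, sub_add_cancel] at this
    exact hTneg j (by omega) (by omega)

/-- The root attached to the `i`-th edge of the `n`-th Farey polygon. -/
def fareyEdge (n : ℕ) (i : ℤ) : V := edgeVec (fareyVertex n i) (fareyVertex n (i + 1))

lemma fareyEdge_mem_Φ (n : ℕ) (i : ℤ) : fareyEdge n i ∈ Φ :=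
  edgeVec_mem_Φ (Or.inl (wedge_fareyVertex_succ n i))

lemma fareyEdge_add_half (n : ℕ) (i : ℤ) : fareyEdge n (i + 2 ^ (n + 1)) = fareyEdge n i := by
  unfold fareyEdge
  rw [add_right_comm, fareyVertex_add_half, fareyVertex_add_half, edgeVec_neg_left,
    edgeVec_neg_right, neg_neg]

lemma fareyEdge_two_mul (n : ℕ) (i : ℤ) : fareyEdge (n + 1) (2 * i) =
    edgeVec (fareyVertex n i) (fareyVertex n i + fareyVertex n (i + 1)) := by
  unfold fareyEdge
  rw [fareyVertex_two_mul, fareyVertex_two_mul_add_one]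

lemma fareyEdge_two_mul_add_one (n : ℕ) (i : ℤ) : fareyEdge (n + 1) (2 * i + 1) =
    edgeVec (fareyVertex n i + fareyVertex n (i + 1)) (fareyVertex n (i + 1)) := by
  unfold fareyEdge
  rw [fareyVertex_two_mul_add_one, show 2 * i + 1 + 1 = 2 * (i + 1) by ring,
    fareyVertex_two_mul]

lemma fareyEdge_two_mul_eq_add (n : ℕ) (i : ℤ) : fareyEdge (n + 1) (2 * i) =
    fareyEdge n i + edgeVec (fareyVertex n i) (fareyVertex n i) := by
  rw [fareyEdge_two_mul, edgeVec_add_right, add_comm, fareyEdge]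

lemma fareyEdge_two_mul_sub_one (n : ℕ) (i : ℤ) : fareyEdge (n + 1) (2 * i - 1) =
    fareyEdge n (i - 1) + edgeVec (fareyVertex n i) (fareyVertex n i) := by
  rw [show 2 * i - 1 = 2 * (i - 1) + 1 by ring, fareyEdge_two_mul_add_one, edgeVec_add_left,
    fareyEdge, sub_add_cancel]

lemma exists_fareyEdge_add_eq (n : ℕ) (i : ℤ) : ∃ k : ℝ, 0 ≤ k ∧
    fareyEdge n (i - 1) + fareyEdge n i = k • edgeVec (fareyVertex n i) (fareyVertex n i) := by
  have h1 := wedge_fareyVertex_succ n (i - 1)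
  have h2 := wedge_fareyVertex_succ n i
  rw [sub_add_cancel] at h1
  have h3 := wedge_fareyVertex_nonneg n (i := i - 1) (j := i + 1) (by omega) (by
    have : (1 : ℤ) ≤ 2 ^ n := one_le_pow₀ (by norm_num)
    rw [pow_succ]; omega)
  refine ⟨(wedge (fareyVertex n (i - 1)) (fareyVertex n (i + 1)) : ℤ), by exact_mod_cast h3, ?_⟩
  unfold fareyEdge
  rw [sub_add_cancel, edgeVec_comm (fareyVertex n i), ← edgeVec_add_left, ← edgeVec_smul_left]
  congr 1
  conv_lhs => rw [eq_smul_add_smul_of_wedge h1 (fareyVertex n (i + 1)), wedge_swap, h2]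
  module

namespace IsPositiveSystem

variable {P : Set V}

lemma add_mem_of_add_eq (hP : IsPositiveSystem P) {a b u : V} {k : ℝ} (hk : 0 ≤ k)
    (h : a + b = k • u) (ha : a ∈ P) (hb : b ∈ P) (hau : a + u ∈ Φ) : a + u ∈ P := by
  rcases hk.eq_or_lt with rfl | hk
  · rw [zero_smul, add_eq_zero_iff_eq_neg'] at h
    exact absurd (h ▸ hb) (hP.neg_notMem a ha)
  · refine hP.mem_of_eq ha hb (s := 1 + 1 / k) (t := 1 / k) (by positivity) (by positivity)
      hau ?_
    rw [eq_sub_of_add_eq' h]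
    match_scalars <;> field_simp
    ring

lemma not_neg_mem_of_add_eq (hP : IsPositiveSystem P) {a b u : V} {k : ℝ} (hk : 0 ≤ k)
    (h : a + b = k • u) (ha : -a ∈ P) (hau : a + u ∈ P) : -(b + u) ∉ P := by
  intro hbu
  refine hP.neg_notMem _ (hP.mem_of_eq hau hbu (x := a) (s := (k + 1) / (k + 2))
    (t := 1 / (k + 2)) (by positivity) (by positivity) ?_ ?_) ha
  · simpa using neg_mem_Φ (hP.subset ha)
  · rw [eq_sub_of_add_eq' h]
    match_scalars <;> field_simp <;> ring

lemma exists_isCut (hP : IsPositiveSystem P) (hsource : ∀ p q, ¬IsSource P p q)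
    (hsink : ∀ p q, ¬IsSource {x | -x ∈ P} p q) (n : ℕ) :
    ∃ A B, IsCut (fareyEdge n · ∈ P) (2 ^ (n + 1)) A B := by
  induction n with
  | zero =>
    have h0 : fareyEdge 0 0 = edgeVec (1, 0) (0, 1) := rfl
    have h1 : fareyEdge 0 1 = -fareyEdge 0 0 := by
      rw [h0, edgeVec_comm, ← edgeVec_neg_right]; rfl
    have h2 : fareyEdge 0 2 = fareyEdge 0 0 := fareyEdge_add_half 0 0
    by_cases h : fareyEdge 0 0 ∈ P
    · refine ⟨0, 1, by norm_num, by norm_num, fun i hi hi' => ?_, fun i hi hi' => ?_⟩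
      · rwa [show i = 0 by omega]
      · rw [show i = 1 by norm_num at hi'; omega, h1]
        exact hP.neg_notMem _ h
    · refine ⟨1, 2, by norm_num, by norm_num, fun i hi hi' => ?_, fun i hi hi' => ?_⟩
      · rw [show i = 1 by omega, h1]
        exact (hP.notMem_iff (fareyEdge_mem_Φ _ _)).mp h
      · rwa [show i = 2 by norm_num at hi'; omega, h2]
  | succ n ih =>
    obtain ⟨A, B, hAB⟩ := ih
    have hneg : ∀ {n i}, fareyEdge n i ∉ P → -fareyEdge n i ∈ P :=
      fun {n i} => (hP.notMem_iff (fareyEdge_mem_Φ n i)).mp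
    rw [pow_succ']
    refine exists_isCut_refinement (S := (fareyEdge n · ∈ P)) (T := (fareyEdge (n + 1) · ∈ P))
      (fun i => by rw [fareyEdge_add_half]) (fun i => by rw [← pow_succ', fareyEdge_add_half])
      (fun i h1 h2 => ?_) (fun i h1 h2 => ?_) (fun i h1 h2 h3 => ?_) (fun i h1 h2 h3 => ?_)
      (fun i h1 h2 => ?_) (fun i h1 => ?_) hAB
    all_goals
      obtain ⟨k, hk, e⟩ := exists_fareyEdge_add_eq n i
      have e' := (add_comm _ _).trans e
      have m1 := fareyEdge_mem_Φ (n + 1) (2 * i)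
      have m2 := fareyEdge_mem_Φ (n + 1) (2 * i - 1)
    · rw [fareyEdge_two_mul_eq_add, fareyEdge_two_mul_sub_one] at *
      exact ⟨hP.add_mem_of_add_eq hk e h1 h2 m2, hP.add_mem_of_add_eq hk e' h2 h1 m1⟩
    · rw [hP.notMem_iff m1, hP.notMem_iff m2]
      have n1 := neg_mem_Φ m1
      have n2 := neg_mem_Φ m2
      rw [fareyEdge_two_mul_eq_add, fareyEdge_two_mul_sub_one] at *
      rw [neg_add] at n1 n2 ⊢
      rw [neg_add]
      refine ⟨hP.add_mem_of_add_eq hk ?_ (hneg h1) (hneg h2) n2,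
        hP.add_mem_of_add_eq hk ?_ (hneg h2) (hneg h1) n1⟩
      · rw [← neg_add, e, smul_neg]
      · rw [← neg_add, e', smul_neg]
    · by_contra h4
      have := hneg h4
      rw [fareyEdge_two_mul_eq_add, fareyEdge_two_mul_sub_one] at *
      exact hP.not_neg_mem_of_add_eq hk e (hneg h1) h3 this
    · by_contra h4
      have := hneg h4
      rw [fareyEdge_two_mul_eq_add, fareyEdge_two_mul_sub_one] at *
      exact hP.not_neg_mem_of_add_eq hk e' (hneg h2) h3 this
    · rw [fareyEdge_two_mul, fareyEdge_two_mul_add_one] at h2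
      exact hsource _ _ ⟨wedge_fareyVertex_succ n i, h1, h2⟩
    · by_contra! h2
      have h3 := hneg h2.1
      have h4 := hneg h2.2
      rw [fareyEdge_two_mul] at h3
      rw [fareyEdge_two_mul_add_one] at h4
      exact hsink _ _ ⟨wedge_fareyVertex_succ n i, hP.neg_notMem _ h1, h3, h4⟩

end IsPositiveSystem

lemma exists_fareyVertex_eq_of_le {n m : ℕ} (h : n ≤ m) (i : ℤ) :
    ∃ j, fareyVertex m j = fareyVertex n i := by
  obtain ⟨k, rfl⟩ := Nat.exists_eq_add_of_le h
  exact ⟨_, fareyVertex_add_pow_mul n k i⟩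

lemma exists_index_of_wedge_pos {n : ℕ} {i j : ℤ}
    (h : 0 < wedge (fareyVertex n i) (fareyVertex n j)) :
    ∃ k, i < k ∧ k < i + 2 ^ (n + 1) ∧ fareyVertex n k = fareyVertex n j := by
  have hper : Function.Periodic (fareyVertex n) (2 ^ (n + 1) + 2 ^ (n + 1)) := fun k => by
    rw [← add_assoc, fareyVertex_add_half, fareyVertex_add_half, neg_neg]
  obtain ⟨k, ⟨hk1, hk2⟩, hk⟩ := hper.exists_mem_Ico (by positivity) j i
  rw [hk] at h
  refine ⟨k, lt_of_le_of_ne hk1 ?_, ?_, hk.symm⟩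
  · rintro rfl
    rw [wedge_self] at h
    exact h.false
  · by_contra! hcon
    have := wedge_fareyVertex_nonneg n (i := i) (j := k - 2 ^ (n + 1)) (by omega) (by omega)
    rw [← sub_add_cancel k (2 ^ (n + 1)), fareyVertex_add_half, wedge_neg_right] at h
    omega

lemma exists_index_of_wedge_pos' {n : ℕ} {i j : ℤ}
    (h : 0 < wedge (fareyVertex n j) (fareyVertex n i)) :
    ∃ k, i - 2 ^ (n + 1) < k ∧ k < i ∧ fareyVertex n k = fareyVertex n j := by
  obtain ⟨k, h1, h2, h3⟩ := exists_index_of_wedge_pos (n := n) (i := i) (j := j + 2 ^ (n + 1))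
    (by rwa [fareyVertex_add_half, wedge_neg_right, ← wedge_swap])
  refine ⟨k - 2 ^ (n + 1), by omega, by omega, ?_⟩
  rw [fareyVertex_add_half] at h3
  rw [← neg_inj, ← fareyVertex_add_half, sub_add_cancel, h3]

/-- The edge `x` joins two lattice vectors of the cone spanned by `p` and `q`. -/
def IsConeEdge (p q : ℤ × ℤ) (x : V) : Prop :=
  ∃ a b c d : ℤ, 0 ≤ a ∧ 0 ≤ b ∧ 0 ≤ c ∧ 0 ≤ d ∧ a * d - b * c = 1 ∧
    x = edgeVec (a • p + b • q) (c • p + d • q)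

lemma isConeEdge_fareyEdge {n : ℕ} {i j k : ℤ} {p q : ℤ × ℤ} (hpq : wedge p q = 1)
    (hk : fareyVertex n k = p) (hj : fareyVertex n j = q)
    (hp : 0 < wedge p (fareyVertex n i)) (hq : 0 < wedge (fareyVertex n i) q) :
    IsConeEdge p q (fareyEdge n (i - 1)) ∧ IsConeEdge p q (fareyEdge n i) := by
  rw [← hk] at hp
  rw [← hj] at hq
  obtain ⟨j', hj1, hj2, hj'⟩ := exists_index_of_wedge_pos hq
  obtain ⟨k', hk1, hk2, hk'⟩ := exists_index_of_wedge_pos' hp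
  rw [hj] at hj'
  rw [hk] at hk'
  have key : ∀ l, i - 1 ≤ l → l ≤ i → IsConeEdge p q (fareyEdge n l) := by
    intro l hl hl'
    have nn : ∀ m, i - 1 ≤ m → m ≤ i + 1 → 0 ≤ wedge (fareyVertex n m) q ∧
        0 ≤ wedge p (fareyVertex n m) := by
      intro m h1 h2
      constructor
      · rw [← hj']
        exact wedge_fareyVertex_nonneg n (by omega) (by omega)
      · rw [← hk']
        exact wedge_fareyVertex_nonneg n (by omega) (by omega)
    obtain ⟨h1, h2⟩ := nn l (by omega) (by omega)
    obtain ⟨h3, h4⟩ := nn (l + 1) (by omega) (by omega)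
    refine ⟨_, _, _, _, h1, h2, h3, h4, ?_, ?_⟩
    · rw [wedge_coords hpq, wedge_fareyVertex_succ]
    · rw [← eq_smul_add_smul_of_wedge hpq, ← eq_smul_add_smul_of_wedge hpq, fareyEdge]
  exact ⟨key _ le_rfl (by omega), key _ (by omega) le_rfl⟩

lemma IsConeEdge.of_neg {p q : ℤ × ℤ} {x : V} (h : IsConeEdge (-p) (-q) x) :
    IsConeEdge p q x := by
  obtain ⟨a, b, c, d, ha, hb, hc, hd, h, rfl⟩ := h
  refine ⟨a, b, c, d, ha, hb, hc, hd, h, ?_⟩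
  rw [show a • -p + b • -q = -(a • p + b • q) by module,
    show c • -p + d • -q = -(c • p + d • q) by module, edgeVec_neg_left, edgeVec_neg_right,
    neg_neg]

lemma EventuallyPos.of_neg {P : Set V} {p : ℤ × ℤ} (hp : EventuallyPos P (-p)) :
    EventuallyPos P p := neg_neg p ▸ hp.neg

lemma IsCut.compl {P : Set V} (hP : IsPositiveSystem P) {n : ℕ} {A B : ℤ}
    (h : IsCut (fareyEdge n · ∈ P) (2 ^ (n + 1)) A B) :
    IsCut (fareyEdge n · ∈ {x | -x ∈ P}) (2 ^ (n + 1)) B (A + 2 ^ (n + 1)) where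
  lt := h.lt_add
  lt_add := by have := h.lt; omega
  pos i h1 h2 := (hP.notMem_iff (fareyEdge_mem_Φ n i)).mp (h.neg i h1 h2)
  neg i h1 h2 := by
    rw [Set.mem_ofPred_eq, ← hP.notMem_iff (fareyEdge_mem_Φ n i), not_not,
      ← sub_add_cancel i (2 ^ (n + 1)), fareyEdge_add_half]
    exact h.pos _ (by omega) (by omega)

lemma IsPositiveSystem.eventuallyPos_fareyVertex {P : Set V} (hP : IsPositiveSystem P) {n : ℕ}
    {i : ℤ} (h1 : fareyEdge n (i - 1) ∈ P) (h2 : fareyEdge n i ∈ P) :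
    EventuallyPos P (fareyVertex n i) := by
  obtain ⟨k, hk, e⟩ := exists_fareyEdge_add_eq n i
  rcases hk.eq_or_lt with rfl | hk
  · rw [zero_smul, add_eq_zero_iff_eq_neg'] at e
    exact absurd (e ▸ h2) (hP.neg_notMem _ h1)
  · refine hP.eventuallyPos (Or.inl (wedge_fareyVertex_succ n i)) hk h2 ?_
    rw [← e]
    change -fareyEdge n i + _ ∈ P
    rwa [add_comm (fareyEdge n (i - 1)), neg_add_cancel_left]

lemma IsCut.eventuallyPos {P : Set V} (hP : IsPositiveSystem P) {n : ℕ} {A B : ℤ}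
    (h : IsCut (fareyEdge n · ∈ P) (2 ^ (n + 1)) A B) {i : ℤ}
    (hi : 0 < wedge (fareyVertex n A) (fareyVertex n i) *
      wedge (fareyVertex n i) (fareyVertex n B)) : EventuallyPos P (fareyVertex n i) := by
  wlog hpos : 0 < wedge (fareyVertex n A) (fareyVertex n i) generalizing i
  · refine EventuallyPos.of_neg ?_
    rw [← fareyVertex_add_half]
    have h0 := (pos_and_pos_or_neg_and_neg_of_mul_pos hi).resolve_left fun h => hpos h.1
    refine this ?_ ?_
    · rw [fareyVertex_add_half, wedge_neg_right, wedge_neg_left]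
      linarith
    · rw [fareyVertex_add_half, wedge_neg_right]
      linarith
  have hB := pos_of_mul_pos_right hi hpos.le
  obtain ⟨j, h1, h2, h3⟩ := exists_index_of_wedge_pos hpos
  rw [← h3] at hB ⊢
  have hjB : j < B := by
    by_contra! hcon
    have := wedge_fareyVertex_nonneg n (i := B) (j := j) hcon (by have := h.lt; omega)
    rw [wedge_swap] at this
    omega
  exact hP.eventuallyPos_fareyVertex (h.pos _ (by omega) (by omega)) (h.pos _ (by omega) hjB)

lemma IsCut.eventuallyPos_compl {P : Set V} (hP : IsPositiveSystem P) {n : ℕ} {A B : ℤ}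
    (h : IsCut (fareyEdge n · ∈ P) (2 ^ (n + 1)) A B) {i : ℤ}
    (hi : wedge (fareyVertex n A) (fareyVertex n i) *
      wedge (fareyVertex n i) (fareyVertex n B) < 0) :
    EventuallyPos {x | -x ∈ P} (fareyVertex n i) := by
  refine (h.compl hP).eventuallyPos hP.neg ?_
  rw [fareyVertex_add_half, wedge_neg_right, wedge_swap (fareyVertex n i),
    wedge_swap (fareyVertex n A) (fareyVertex n i)]
  linarith

/-- `x` and `y` are limits of the directions where the edges of the Farey polygons change from
not being in `P` to being in `P` and conversely. -/
structure IsLimitCut (P : Set V) (x y : ℝ × ℝ) : Prop where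
  left_ne_zero : x ≠ 0
  right_ne_zero : y ≠ 0
  eventuallyPos : ∀ z q : ℤ × ℤ, wedge z q = 1 → 0 < crossForm x y (edgeVec z z) →
    EventuallyPos P z
  eventuallyPos_compl : ∀ z q : ℤ × ℤ, wedge z q = 1 → crossForm x y (edgeVec z z) < 0 →
    EventuallyPos {x | -x ∈ P} z
  boundary : ∀ p q : ℤ × ℤ, wedge p q = 1 →
    0 < realWedge (toReal p) x * realWedge x (toReal q) →
    (∃ e ∈ P, IsConeEdge p q e) ∧ ∃ e, -e ∈ P ∧ IsConeEdge p q e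

lemma crossForm_neg_right (x y : ℝ × ℝ) (X : V) : crossForm x (-y) X = -crossForm x y X := by
  simp [crossForm]; ring

lemma IsLimitCut.compl {P : Set V} {x y : ℝ × ℝ} (h : IsLimitCut P x y) :
    IsLimitCut {x | -x ∈ P} x (-y) where
  left_ne_zero := h.left_ne_zero
  right_ne_zero := neg_ne_zero.mpr h.right_ne_zero
  eventuallyPos z q hzq hz := by
    rw [crossForm_neg_right, Left.neg_pos_iff] at hz
    exact h.eventuallyPos_compl z q hzq hz
  eventuallyPos_compl z q hzq hz := by
    rw [crossForm_neg_right, Left.neg_neg_iff] at hz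
    simpa using h.eventuallyPos z q hzq hz
  boundary p q hpq hx := by
    simpa using (h.boundary p q hpq hx).symm

lemma realWedge_smul_left (c : ℝ) (x y : ℝ × ℝ) : realWedge (c • x) y = c * realWedge x y := by
  simp [realWedge]; ring

lemma realWedge_smul_right (c : ℝ) (x y : ℝ × ℝ) : realWedge x (c • y) = c * realWedge x y := by
  simp [realWedge]; ring

lemma crossForm_edgeVec_self (x y : ℝ × ℝ) (z : ℤ × ℤ) : crossForm x y (edgeVec z z) =
    realWedge x (toReal z) * realWedge (toReal z) y := by
  rw [crossForm_edgeVec]; ring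

lemma toReal_fareyVertex_ne_zero (n : ℕ) (i : ℤ) : toReal (fareyVertex n i) ≠ 0 := by
  intro h
  have := wedge_fareyVertex_succ n i
  have h' := realWedge_toReal (fareyVertex n i) (fareyVertex n (i + 1))
  rw [h, this] at h'
  simp [realWedge] at h'

lemma exists_isLimitCut {P : Set V} (hP : IsPositiveSystem P)
    (h : ∀ n : ℕ, ∃ A B, IsCut (fareyEdge n · ∈ P) (2 ^ (n + 1)) A B) :
    ∃ x y, IsLimitCut P x y := by
  choose A B hAB using h
  set a : ℕ → ℝ × ℝ := fun n => toReal (fareyVertex n (A n)) with ha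
  set b : ℕ → ℝ × ℝ := fun n => toReal (fareyVertex n (B n)) with hb
  have ha0 : ∀ n, 0 < ‖a n‖⁻¹ := fun n =>
    inv_pos.mpr (norm_pos_iff.mpr (toReal_fareyVertex_ne_zero _ _))
  have hb0 : ∀ n, 0 < ‖b n‖⁻¹ := fun n =>
    inv_pos.mpr (norm_pos_iff.mpr (toReal_fareyVertex_ne_zero _ _))
  obtain ⟨⟨x, y⟩, ⟨hx, hy⟩, φ, hφ, hlim⟩ :=
    ((isCompact_sphere (0 : ℝ × ℝ) 1).prod (isCompact_sphere (0 : ℝ × ℝ) 1)).tendsto_subseq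
      (x := fun n => (‖a n‖⁻¹ • a n, ‖b n‖⁻¹ • b n)) (fun n => by
        constructor
        · simp [norm_smul, toReal_fareyVertex_ne_zero, ha]
        · simp [norm_smul, toReal_fareyVertex_ne_zero, hb])
  have hφ' := hφ.tendsto_atTop
  have hlim1 := (continuous_fst.tendsto _).comp hlim
  have hprod : ∀ z : ℤ × ℤ, Filter.Tendsto (fun n => ‖a (φ n)‖⁻¹ * ‖b (φ n)‖⁻¹ *
      (wedge (fareyVertex (φ n) (A (φ n))) z * wedge z (fareyVertex (φ n) (B (φ n))) : ℤ))
      Filter.atTop (nhds (crossForm x y (edgeVec z z))) := by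
    intro z
    have hc : Continuous fun w : (ℝ × ℝ) × (ℝ × ℝ) =>
        realWedge w.1 (toReal z) * realWedge (toReal z) w.2 := by
      unfold realWedge; fun_prop
    rw [crossForm_edgeVec_self]
    refine ((hc.tendsto (x, y)).comp hlim).congr fun n => ?_
    simp only [Function.comp_apply, realWedge_smul_left, realWedge_smul_right, ha, hb,
      realWedge_toReal]
    push_cast
    ring
  have hlevel : ∀ z q : ℤ × ℤ, wedge z q = 1 → ∀ᶠ n in Filter.atTop,
      ∃ i, fareyVertex (φ n) i = z := by
    intro z q hzq
    obtain ⟨n, i, rfl⟩ := exists_fareyVertex_eq hzq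
    filter_upwards [hφ'.eventually_ge_atTop n] with m hm
    exact exists_fareyVertex_eq_of_le hm i
  refine ⟨x, y, ?_, ?_, fun z q hzq hz => ?_, fun z q hzq hz => ?_, fun p q hpq hx' => ?_⟩
  · rintro rfl; simp at hx
  · rintro rfl; simp at hy
  · obtain ⟨n, hn, i, rfl⟩ := (((hprod z).eventually_const_lt hz).and (hlevel z q hzq)).exists
    have := pos_of_mul_pos_right hn (mul_pos (ha0 _) (hb0 _)).le
    exact (hAB (φ n)).eventuallyPos hP (by exact_mod_cast this)
  · obtain ⟨n, hn, i, rfl⟩ := (((hprod z).eventually_lt_const hz).and (hlevel z q hzq)).exists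
    have := neg_of_mul_neg_right hn (mul_pos (ha0 _) (hb0 _)).le
    exact (hAB (φ n)).eventuallyPos_compl hP (by exact_mod_cast this)
  · have hc : Continuous fun w : ℝ × ℝ =>
        realWedge (toReal p) w * realWedge w (toReal q) := by
      unfold realWedge; fun_prop
    have hqp : wedge q (-p) = 1 := by rw [wedge_neg_right, wedge_swap, neg_neg, hpq]
    obtain ⟨n, ⟨hn, k, hk⟩, j, hj⟩ := (((((hc.tendsto x).comp hlim1).eventually_const_lt
      hx').and (hlevel p q hpq)).and (hlevel q _ hqp)).exists
    have h0 : 0 < wedge p (fareyVertex (φ n) (A (φ n))) *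
        wedge (fareyVertex (φ n) (A (φ n))) q := by
      replace hn : 0 < realWedge (toReal p) (‖a (φ n)‖⁻¹ • a (φ n)) *
          realWedge (‖a (φ n)‖⁻¹ • a (φ n)) (toReal q) := hn
      rw [realWedge_smul_left, realWedge_smul_right, mul_mul_mul_comm, ha, realWedge_toReal,
        realWedge_toReal] at hn
      exact_mod_cast pos_of_mul_pos_right hn (mul_pos (ha0 _) (ha0 _)).le
    have key : IsConeEdge p q (fareyEdge (φ n) (A (φ n) - 1)) ∧
        IsConeEdge p q (fareyEdge (φ n) (A (φ n))) := by
      rcases pos_and_pos_or_neg_and_neg_of_mul_pos h0 with ⟨h1, h2⟩ | ⟨h1, h2⟩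
      · exact isConeEdge_fareyEdge hpq hk hj h1 h2
      · refine (isConeEdge_fareyEdge (p := -p) (q := -q)
          (by rw [wedge_neg_left, wedge_neg_right, neg_neg, hpq])
          (by rw [fareyVertex_add_half, hk]) (by rw [fareyVertex_add_half, hj])
          (by rw [wedge_neg_left]; omega) (by rw [wedge_neg_right]; omega)).imp
          IsConeEdge.of_neg IsConeEdge.of_neg
    have hcut := hAB (φ n)
    refine ⟨⟨_, hcut.pos _ le_rfl hcut.lt, key.2⟩, ⟨_, ?_, key.1⟩⟩
    rw [← hP.notMem_iff (fareyEdge_mem_Φ _ _), ← fareyEdge_add_half]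
    have := hcut.lt_add
    exact hcut.neg _ (by omega) (by omega)

lemma crossForm_ne_zero {x y : ℝ × ℝ} (hx : x ≠ 0) (hy : y ≠ 0) : crossForm x y ≠ 0 := by
  intro h
  have h1 := LinearMap.congr_fun h ![1, 1, 0]
  have h2 := LinearMap.congr_fun h ![0, 1, 1]
  have h3 := LinearMap.congr_fun h ![0, -2, 0]
  simp [crossForm] at h1 h2 h3
  rw [ne_eq, Prod.ext_iff] at hx hy
  simp only [Prod.fst_zero, Prod.snd_zero] at hx hy
  rcases h1 with h1 | h1 <;> rcases h2 with h2 | h2 <;> simp_all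

lemma exists_coprime_abs_lt {A C E : ℝ} (h : A * C < E ^ 2) (hE : E < 0) :
    ∃ a b : ℤ, 0 < a ∧ 0 < b ∧ IsCoprime a b ∧
      0 < A * a ^ 2 - 2 * a * b * E + C * b ^ 2 ∧ A * a ^ 2 + 2 * a * b * E + C * b ^ 2 < 0 := by
  obtain ⟨r, hr0, hr⟩ : ∃ r : ℝ, 0 < r ∧ |A + C * r ^ 2| < 2 * -E * r := by
    rcases eq_or_ne A 0 with rfl | hA
    · refine ⟨-E / (|C| + 1), by have := abs_nonneg C; apply div_pos <;> linarith, ?_⟩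
      have hr : 0 < -E / (|C| + 1) := by have := abs_nonneg C; apply div_pos <;> linarith
      have h1 : |C| * (-E / (|C| + 1)) < 2 * -E := by
        rw [mul_div_assoc', div_lt_iff₀ (by positivity)]
        nlinarith [abs_nonneg C]
      rw [zero_add, abs_mul, abs_of_pos (by positivity : (0 : ℝ) < (-E / (|C| + 1)) ^ 2), sq,
        ← mul_assoc]
      exact mul_lt_mul_of_pos_right h1 hr
    rcases eq_or_ne C 0 with rfl | hC
    · refine ⟨|A| / -E, div_pos (abs_pos.mpr hA) (by linarith), ?_⟩
      rw [zero_mul, add_zero, mul_assoc, mul_div_cancel₀ _ (by linarith : -E ≠ 0)]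
      linarith [abs_pos.mpr hA]
    · have hAC : 0 < |A / C| := abs_pos.mpr (div_ne_zero hA hC)
      refine ⟨√|A / C|, Real.sqrt_pos.mpr hAC, ?_⟩
      rw [Real.sq_sqrt hAC.le]
      have h2 : 0 < 2 * -E * √|A / C| := by
        have := Real.sqrt_pos.mpr hAC
        have : 0 < -E := by linarith
        positivity
      rcases lt_or_gt_of_ne (div_ne_zero hA hC) with h0 | h0
      · rw [abs_of_neg h0, mul_neg, mul_div_cancel₀ _ hC, add_neg_cancel, abs_zero,
          ← abs_of_neg h0]
        exact h2
      · refine abs_lt_of_sq_lt_sq ?_ h2.le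
        rw [mul_pow, Real.sq_sqrt hAC.le, abs_of_pos h0, mul_div_cancel₀ _ hC]
        have h4 : A ^ 2 = A * C * (A / C) := by field_simp
        nlinarith
  have hopen : IsOpen {r : ℝ | 0 < r ∧ |A + C * r ^ 2| < 2 * -E * r} :=
    (isOpen_lt continuous_const continuous_id).inter
      (isOpen_lt (f := fun r : ℝ => |A + C * r ^ 2|) (g := fun r : ℝ => 2 * -E * r)
        (by fun_prop) (by fun_prop))
  obtain ⟨t, ht0, ht⟩ := Rat.denseRange_cast.exists_mem_open hopen ⟨r, hr0, hr⟩
  have hd : (0 : ℝ) < t.den := by exact_mod_cast t.den_pos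
  have hnum : (t : ℝ) * t.den = t.num := by exact_mod_cast Rat.mul_den_eq_num t
  refine ⟨t.den, t.num, by exact_mod_cast t.den_pos, ?_, ?_, ?_⟩
  · exact Rat.num_pos.mpr (by exact_mod_cast ht0)
  · exact (Rat.isCoprime_num_den t).symm
  · rw [abs_lt] at ht
    rw [← hnum]
    push_cast
    have hd2 : (0 : ℝ) < t.den ^ 2 := by positivity
    constructor
    · nlinarith [mul_pos hd2 (sub_pos.mpr ht.1)]
    · nlinarith [mul_pos hd2 (sub_pos.mpr ht.2)]

namespace IsLimitCut

variable {P : Set V} {x y : ℝ × ℝ}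

lemma nonneg_of_realWedge_ne_zero (hP : IsPositiveSystem P) (h : IsLimitCut P x y)
    (hxy : realWedge x y ≠ 0) {p q : ℤ × ℤ} (hpq : wedge p q = 1) (he : edgeVec p q ∈ P) :
    0 ≤ crossForm x y (edgeVec p q) := by
  by_contra! hneg
  obtain ⟨a, b, ha, hb, ⟨d, c, hcd⟩, h1, h2⟩ := exists_coprime_abs_lt
    (A := crossForm x y (edgeVec p p)) (C := crossForm x y (edgeVec q q)) (by
      have hpq' : realWedge (toReal p) (toReal q) = 1 := by rw [realWedge_toReal, hpq]; simp
      have : crossForm x y (edgeVec p q) ^ 2 - crossForm x y (edgeVec p p) *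
          crossForm x y (edgeVec q q) =
          (realWedge x y * realWedge (toReal p) (toReal q)) ^ 2 / 4 := by
        simp only [crossForm_edgeVec]
        unfold realWedge
        ring
      rw [hpq', mul_one] at this
      have := sq_pos_of_ne_zero hxy
      linarith) hneg
  have hcd' : a * d + b * c = 1 := by linarith
  have hwp : wedge (a • p - b • q) (c • p + d • q) = 1 := by
    have : wedge (a • p - b • q) (c • p + d • q) = (a * d + b * c) * wedge p q := by
      simp [wedge]; ring
    rw [this, hcd', hpq, one_mul]
  have hwm : wedge (a • p + b • q) (d • q - c • p) = 1 := by
    have : wedge (a • p + b • q) (d • q - c • p) = (a * d + b * c) * wedge p q := by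
      simp [wedge]; ring
    rw [this, hcd', hpq, one_mul]
  have hu : ∀ s : ℤ, edgeVec (a • p + s • q) (a • p + s • q) = ((a : ℝ) ^ 2) • edgeVec p p +
      (2 * a * s : ℝ) • edgeVec p q + ((s : ℝ) ^ 2) • edgeVec q q := by
    intro s
    simp only [edgeVec_add_left, edgeVec_add_right, edgeVec_smul_left, edgeVec_smul_right,
      edgeVec_comm q p]
    module
  have hsub : a • p - b • q = a • p + (-b) • q := by module
  obtain ⟨M, hM⟩ := h.eventuallyPos _ _ hwp (by
    rw [hsub, hu]
    simp only [map_add, map_smul, smul_eq_mul]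
    push_cast
    linarith) _ (Or.inl hwp)
  obtain ⟨M', hM'⟩ := h.eventuallyPos_compl _ _ hwm (by
    rw [hu]
    simp only [map_add, map_smul, smul_eq_mul]
    linarith) (-(d • q - c • p)) (Or.inr (by rw [wedge_neg_right, hwm]))
  obtain ⟨m, hm⟩ := exists_nat_gt (|(a * d - b * c : ℝ)|)
  have hab : (1 : ℝ) ≤ a * b := by exact_mod_cast mul_pos ha hb
  set k : ℕ := max m (max M M') with hk
  have hk1 := hM k (by omega)
  have hk2 := hM' k (by omega)
  rw [Set.mem_ofPred_eq] at hk2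
  have hkm : |(a * d - b * c : ℝ)| < k := hm.trans_le (by exact_mod_cast le_max_left _ _)
  have hpos : 0 < 4 * (a * b) * k - 2 * (a * d - b * c : ℝ) := by
    have := le_abs_self (a * d - b * c : ℝ)
    have := abs_nonneg (a * d - b * c : ℝ)
    nlinarith
  refine hP.neg_notMem _ he (hP.mem_of_eq hk1 hk2
    (s := (4 * (a * b) * k - 2 * (a * d - b * c : ℝ))⁻¹)
    (t := (4 * (a * b) * k - 2 * (a * d - b * c : ℝ))⁻¹) (by positivity) (by positivity)
    (neg_mem_Φ (hP.subset he)) ?_)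
  rw [← smul_add, eq_inv_smul_iff₀ hpos.ne', hsub, hu, hu, edgeVec_neg_right,
    show d • q - c • p = (-c) • p + d • q by module]
  simp only [edgeVec_add_left, edgeVec_add_right, edgeVec_smul_left, edgeVec_smul_right,
    edgeVec_comm q p]
  push_cast
  module

lemma nonneg_of_neg_smul (hP : IsPositiveSystem P) {l : ℝ} (hl : l < 0)
    (h : IsLimitCut P x (l • x)) {p q : ℤ × ℤ} (hpq : wedge p q = 1) (he : edgeVec p q ∈ P) :
    0 ≤ crossForm x (l • x) (edgeVec p q) := by
  by_contra! hneg
  have hf : ∀ z w, crossForm x (l • x) (edgeVec z w) =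
      -l * (realWedge x (toReal z) * realWedge x (toReal w)) := by
    intro z w
    rw [crossForm_edgeVec]
    simp [realWedge]
    ring
  have hl' : 0 < -l := by linarith
  rw [hf] at hneg
  replace hneg := neg_of_mul_neg_right hneg hl'.le
  have hp0 : realWedge x (toReal p) ≠ 0 := fun h0 => by simp [h0] at hneg
  have hq0 : realWedge x (toReal q) ≠ 0 := fun h0 => by simp [h0] at hneg
  have hp := h.eventuallyPos p q hpq (by rw [hf]; exact mul_pos hl' (mul_self_pos.mpr hp0))
  have hq := h.eventuallyPos q (-p) (by rw [wedge_neg_right, wedge_swap, neg_neg, hpq])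
    (by rw [hf]; exact mul_pos hl' (mul_self_pos.mpr hq0))
  obtain ⟨-, e, he', a, b, c, d, ha, hb, hc, hd, hdet, rfl⟩ := h.boundary p q hpq (by
    have : realWedge (toReal p) x = -realWedge x (toReal p) := by unfold realWedge; ring
    rw [this]
    linarith)
  exact hP.neg_notMem _ (hP.edgeVec_combo_mem hpq hp hq he ha hb hc hd hdet) he'

lemma nonneg (hP : IsPositiveSystem P) (h : IsLimitCut P x y) {z : V} (hz : z ∈ P) :
    0 ≤ crossForm x y z := by
  obtain ⟨p, q, hpq, rfl⟩ := exists_wedge_eq_one_of_mem_Φ (hP.subset hz)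
  by_cases hxy : realWedge x y = 0
  · obtain ⟨l, rfl⟩ : ∃ l : ℝ, y = l • x := by
      unfold realWedge at hxy
      by_cases hx : x.1 = 0
      · have hx2 : x.2 ≠ 0 := fun h2 => h.left_ne_zero (Prod.ext hx h2)
        refine ⟨y.2 / x.2, Prod.ext ?_ ?_⟩
        · simp_all
        · simp [hx2]
      · refine ⟨y.1 / x.1, Prod.ext ?_ ?_⟩
        · simp [hx]
        · simp
          field_simp
          linarith
    rcases lt_trichotomy l 0 with hl | rfl | hl
    · exact h.nonneg_of_neg_smul hP hl hpq hz
    · exact absurd (zero_smul ℝ x) h.right_ne_zero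
    · have h' := h.compl
      rw [← neg_smul] at h'
      have := h'.nonneg_of_neg_smul hP.neg (neg_lt_zero.mpr hl) (p := q) (q := -p)
        (by rw [wedge_neg_right, wedge_swap, neg_neg, hpq])
        (by rwa [edgeVec_neg_right, Set.mem_ofPred_eq, neg_neg, edgeVec_comm])
      rwa [neg_smul, crossForm_neg_right, edgeVec_neg_right, map_neg, neg_neg,
        edgeVec_comm] at this
  · exact h.nonneg_of_realWedge_ne_zero hP hxy hpq hz

end IsLimitCut

lemma IsPositiveSystem.exists_nonneg_functional {P : Set V} (hP : IsPositiveSystem P) :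
    ∃ f : V →ₗ[ℝ] ℝ, f ≠ 0 ∧ ∀ x ∈ P, 0 ≤ f x := by
  by_cases hsource : ∃ p q, IsSource P p q
  · obtain ⟨p, q, h⟩ := hsource
    exact h.exists_functional hP
  by_cases hsink : ∃ p q, IsSource {x | -x ∈ P} p q
  · obtain ⟨p, q, h⟩ := hsink
    obtain ⟨f, hf, hfP⟩ := h.exists_functional hP.neg
    refine ⟨-f, neg_ne_zero.mpr hf, fun x hx => ?_⟩
    simpa using hfP (-x) (by simpa using hx)
  push Not at hsource hsink
  obtain ⟨x, y, h⟩ := exists_isLimitCut hP (hP.exists_isCut hsource hsink)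
  exact ⟨_, crossForm_ne_zero h.left_ne_zero h.right_ne_zero, fun z hz => h.nonneg hP hz⟩

namespace IsPositiveSystem

variable {P : Set V}

lemma smul_add_smul_add_smul_ne_zero (hP : IsPositiveSystem P) {a b c : V} (ha : a ∈ P)
    (hb : b ∈ P) (hc : c ∈ P) {r s t : ℝ} (hr : 0 < r) (hs : 0 ≤ s) (ht : 0 ≤ t) :
    r • a + s • b + t • c ≠ 0 := by
  intro h
  refine hP.neg_notMem a ha ?_
  refine hP.mem_of_eq hb hc (s := s / r) (t := t / r) (by positivity) (by positivity)
    (neg_mem_Φ (hP.subset ha)) ?_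
  have : a = r⁻¹ • (r • a) := by rw [smul_smul, inv_mul_cancel₀ hr.ne', one_smul]
  rw [this, eq_neg_of_add_eq_zero_left ((add_assoc _ _ _).symm.trans h)]
  module

lemma zero_notMem_convexHull (hP : IsPositiveSystem P) {s : Set V} (hs : s ⊆ P) :
    (0 : V) ∉ convexHull ℝ s := by
  intro h0
  obtain ⟨ι, _, z, w, hz, hind, hw, hw1, hwz⟩ := eq_pos_convex_span_of_mem_convexHull h0
  have hzP : ∀ i, z i ∈ P := fun i => hs (hz ⟨i, rfl⟩)
  obtain ⟨f, hf, hfP⟩ := hP.exists_nonneg_functional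
  have hfz : ∀ i, f (z i) = 0 := by
    have hsum : ∑ i, w i * f (z i) = 0 := by simpa using congrArg f hwz
    intro i
    have := (Finset.sum_eq_zero_iff_of_nonneg
      (fun i _ => mul_nonneg (hw i).le (hfP _ (hzP i)))).mp hsum i (Finset.mem_univ i)
    exact (mul_eq_zero.mp this).resolve_left (hw i).ne'
  have hle : vectorSpan ℝ (Set.range z) ≤ LinearMap.ker f := by
    rw [vectorSpan, Submodule.span_le]
    rintro _ ⟨_, ⟨i, rfl⟩, _, ⟨j, rfl⟩, rfl⟩
    simp [hfz]
  have hker : Module.finrank ℝ (LinearMap.ker f) < 3 := by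
    have := Submodule.finrank_lt (s := LinearMap.ker f) (by simpa using hf)
    simpa using this
  have hcard : Fintype.card ι ≤ 3 := by
    exact (hind.card_le_finrank_succ.trans (Nat.succ_le_succ (Submodule.finrank_mono hle))).trans
      hker
  obtain ⟨n, hn, ⟨e⟩⟩ : ∃ n ≤ 3, Nonempty (ι ≃ Fin n) := ⟨_, hcard, ⟨Fintype.equivFin ι⟩⟩
  have hsum1 : ∑ k, w (e.symm k) = 1 := by rw [← hw1]; exact e.symm.sum_comp w
  have hsum2 : ∑ k, w (e.symm k) • z (e.symm k) = 0 := by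
    rw [← hwz]; exact e.symm.sum_comp fun i => w i • z i
  interval_cases n
  · simp at hsum1
  · rw [Fin.sum_univ_one] at hsum2
    have := hP.smul_add_smul_add_smul_ne_zero (hzP (e.symm 0)) (hzP (e.symm 0)) (hzP (e.symm 0))
      (hw (e.symm 0)) le_rfl le_rfl
    simp_all
  · rw [Fin.sum_univ_two] at hsum2
    have := hP.smul_add_smul_add_smul_ne_zero (hzP (e.symm 0)) (hzP (e.symm 1)) (hzP (e.symm 1))
      (hw (e.symm 0)) (hw (e.symm 1)).le le_rfl
    simp_all
  · rw [Fin.sum_univ_three] at hsum2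
    exact hP.smul_add_smul_add_smul_ne_zero (hzP _) (hzP _) (hzP _) (hw _) (hw _).le (hw _).le hsum2

lemma exists_pos_functional (hP : IsPositiveSystem P) (F : Finset V) :
    ∃ f : V →ₗ[ℝ] ℝ, ∀ x ∈ F, x ∈ P → 0 < f x := by
  have hfin : {x | x ∈ F ∧ x ∈ P}.Finite := F.finite_toSet.subset fun x hx => hx.1
  obtain ⟨f, u, hu, hf⟩ := geometric_hahn_banach_point_closed 
    (convex_convexHull ℝ {x | x ∈ F ∧ x ∈ P}) (hfin.isClosed_convexHull ℝ) (hP.zero_notMem_convexHull fun x hx => hx.2)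
  refine ⟨f.toLinearMap, fun x hxF hxP => ?_⟩
  have := hf x (subset_convexHull ℝ _ ⟨hxF, hxP⟩)
  rw [map_zero] at hu
  exact hu.trans this

end IsPositiveSystem

lemma IsClosedSet.mem_of_eq {R : Set V} (hR : IsClosedSet R) {a b x : V} (ha : a ∈ R) (hb : b ∈ R)
    {s t : ℝ} (hs : 0 ≤ s) (ht : 0 ≤ t) (hx : x ∈ Φpos) (h : s • a + t • b = x) : x ∈ R :=
  hR a ha b hb ⟨mem_nnspan_pair.mpr ⟨s, t, hs, ht, h⟩, hx⟩

namespace IsBiclosed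

variable {R : Set V}

lemma mem_of_sub (hR : IsBiclosed R) {a c x : V} (ha : a ∈ R) (hc : c ∈ Φpos \ R) {s t : ℝ}
    (hs : 0 ≤ s) (ht : 0 ≤ t) (hx : x ∈ Φ) (h : x = s • a - t • c) :
    x ∈ R ∨ (-x ∈ Φpos ∧ -x ∉ R) := by
  have ha' := hR.1 ha
  rcases mem_Φpos_or_neg_mem hx with hp | hp
  · left
    by_contra hxR
    rcases hs.eq_or_lt with rfl | hs
    · refine neg_notMem_Φpos hp (mem_Φpos.mpr ⟨neg_mem_Φ hx, fun i => ?_⟩)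
      have := (mem_Φpos.mp hc.1).2 i
      simp [h]; positivity
    · refine (hR.2.2.mem_of_eq ⟨hp, hxR⟩ hc (s := s⁻¹) (t := t / s) (by positivity)
        (by positivity) ha' ?_).2 ha
      rw [h]
      match_scalars <;> field_simp
      ring
  · right
    refine ⟨hp, fun hxR => ?_⟩
    rcases ht.eq_or_lt with rfl | ht
    · refine neg_notMem_Φpos hp (mem_Φpos.mpr ⟨neg_mem_Φ (neg_mem_Φ hx), fun i => ?_⟩)
      have := (mem_Φpos.mp ha').2 i
      simp [h]; positivity
    · refine hc.2 (hR.2.1.mem_of_eq hxR ha (s := t⁻¹) (t := s / t) (by positivity)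
        (by positivity) hc.1 ?_)
      rw [h]
      match_scalars <;> field_simp
      ring

lemma isPositiveSystem (hR : IsBiclosed R) :
    IsPositiveSystem {x | x ∈ R ∨ (-x ∈ Φpos ∧ -x ∉ R)} where
  subset x hx := by
    rcases hx with hx | hx
    · exact (hR.1 hx).1
    · simpa using neg_mem_Φ hx.1.1
  mem_or_neg_mem x hx := by
    simp only [Set.mem_ofPred_eq, neg_neg]
    rcases mem_Φpos_or_neg_mem hx with h | h <;> tauto
  neg_notMem x hx := by
    simp only [Set.mem_ofPred_eq, neg_neg] at hx ⊢
    rintro (h | h)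
    · rcases hx with hx | hx
      · exact neg_notMem_Φpos (hR.1 hx) (hR.1 h)
      · exact hx.2 h
    · rcases hx with hx | hx
      · exact h.2 hx
      · exact neg_notMem_Φpos h.1 hx.1
  smul_add_smul_mem a ha b hb s t hs ht h := by
    simp only [Set.mem_ofPred_eq] at ha hb ⊢
    rcases ha with ha | ha <;> rcases hb with hb | hb
    · have hpos : s • a + t • b ∈ Φpos := smul_add_smul_mem_Φpos (hR.1 ha) (hR.1 hb) hs ht h
      exact Or.inl (hR.2.1.mem_of_eq ha hb hs ht hpos rfl)
    · exact hR.mem_of_sub ha hb hs ht h (by module)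
    · exact hR.mem_of_sub hb ha ht hs h (by module)
    · have e : -(s • a + t • b) = s • -a + t • -b := by module
      have hpos : s • -a + t • -b ∈ Φpos :=
        smul_add_smul_mem_Φpos ha.1 hb.1 hs ht (e ▸ neg_mem_Φ h)
      exact Or.inr (e ▸ hR.2.2.mem_of_eq ha hb hs ht hpos rfl)

/-- Every biclosed set is an ultralimit of sets cut out by linear functionals. -/
lemma exists_functionals (hR : IsBiclosed R) : ∃ f : Finset V → V →ₗ[ℝ] ℝ,
    (∀ x ∈ R, ∀ᶠ F in Filter.atTop, 0 < f F x) ∧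
      ∀ x ∈ Φpos \ R, ∀ᶠ F in Filter.atTop, f F x < 0 := by
  choose f hf using hR.isPositiveSystem.exists_pos_functional
  have key : ∀ x, (x ∈ R ∨ (-x ∈ Φpos ∧ -x ∉ R)) → ∀ᶠ F in Filter.atTop, 0 < f F x := by
    intro x hx
    filter_upwards [Filter.eventually_ge_atTop {x}] with F hF
    exact hf F x (hF (Finset.mem_singleton_self x)) hx
  refine ⟨f, fun x hx => key x (Or.inl hx), fun x hx => ?_⟩
  filter_upwards [key (-x) (Or.inr (by simpa using hx))] with F hF
  simpa using hF

end IsBiclosed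

lemma exists_functional_separating {β γ : V} (hβ : β ∈ Φpos) (hγ : γ ∈ Φpos) (h : γ ≠ β) :
    ∃ k : V →ₗ[ℝ] ℝ, k β = 0 ∧ 0 < k γ := by
  have hspan : γ ∉ Submodule.span ℝ {β} := by
    intro hmem
    obtain ⟨c, rfl⟩ := Submodule.mem_span_singleton.mp hmem
    have h1 := Q_eq_one_of_mem_Φ hβ.1
    have h2 := Q_eq_one_of_mem_Φ hγ.1
    have h3 : Q (c • β) = c ^ 2 * Q β := by
      simp only [Q, B, Fin.sum_univ_three, Pi.smul_apply, smul_eq_mul]; ring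
    rw [h3, h1, mul_one] at h2
    replace h2 : c = 1 ∨ c = -1 := by simpa using h2
    rcases h2 with rfl | rfl
    · exact h (one_smul ℝ β)
    · rw [neg_one_smul] at hγ
      exact neg_notMem_Φpos hβ hγ
  obtain ⟨k, hk, hle⟩ := Submodule.exists_le_ker_of_notMem hspan
  have hkβ : k β = 0 := hle (Submodule.mem_span_singleton_self β)
  rcases hk.lt_or_gt with h | h
  · exact ⟨-k, by simp [hkβ], by simpa using h⟩
  · exact ⟨k, hkβ, h⟩

lemma lex_pos_add {x y x' y' s t : ℝ} (hx : 0 < x ∨ (x = 0 ∧ 0 < x'))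
    (hy : 0 < y ∨ (y = 0 ∧ 0 < y')) (hs : 0 ≤ s) (ht : 0 ≤ t) (hst : s ≠ 0 ∨ t ≠ 0) :
    0 < s * x + t * y ∨ (s * x + t * y = 0 ∧ 0 < s * x' + t * y') := by
  rcases hs.eq_or_lt with rfl | hs <;> rcases ht.eq_or_lt with rfl | ht
  · simp at hst
  · simpa [ht, ht.ne'] using hy
  · simpa [hs, hs.ne'] using hx
  · rcases hx with hx | ⟨rfl, hx⟩ <;> rcases hy with hy | ⟨rfl, hy⟩
    · left; positivity
    · left; simp [hs, hx]
    · left; simp [ht, hy]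
    · right; exact ⟨by simp, by positivity⟩

lemma not_lex_pos_add {x y x' y' s t : ℝ} (hx : ¬(0 < x ∨ (x = 0 ∧ 0 < x')))
    (hy : ¬(0 < y ∨ (y = 0 ∧ 0 < y'))) (hs : 0 ≤ s) (ht : 0 ≤ t) :
    ¬(0 < s * x + t * y ∨ (s * x + t * y = 0 ∧ 0 < s * x' + t * y')) := by
  push Not at hx hy ⊢
  refine ⟨by nlinarith [mul_nonneg hs (neg_nonneg.mpr hx.1), mul_nonneg ht (neg_nonneg.mpr hy.1)],
    fun h => ?_⟩
  have hsx := mul_nonneg hs (neg_nonneg.mpr hx.1)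
  have hty := mul_nonneg ht (neg_nonneg.mpr hy.1)
  have h1 : s * x' ≤ 0 := by
    rcases mul_eq_zero.mp (show s * x = 0 by linarith) with rfl | h0
    · simp
    · exact mul_nonpos_of_nonneg_of_nonpos hs (hx.2 h0)
  have h2 : t * y' ≤ 0 := by
    rcases mul_eq_zero.mp (show t * y = 0 by linarith) with rfl | h0
    · simp
    · exact mul_nonpos_of_nonneg_of_nonpos ht (hy.2 h0)
  linarith

/-- The roots that are eventually lexicographically positive form a biclosed set. -/
lemma isBiclosed_lex {ι : Type*} (U : Ultrafilter ι) (h : ι → V →ₗ[ℝ] ℝ) (k : V →ₗ[ℝ] ℝ) :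
    IsBiclosed {x | x ∈ Φpos ∧ ∀ᶠ i in U, 0 < h i x ∨ (h i x = 0 ∧ 0 < k x)} := by
  refine ⟨fun x hx => hx.1, ?_, ?_⟩
  · rintro a ⟨ha, ha'⟩ b ⟨hb, hb'⟩ x ⟨hx, hxpos⟩
    obtain ⟨s, t, hs, ht, rfl⟩ := mem_nnspan_pair.mp hx
    refine ⟨hxpos, ?_⟩
    have hst : s ≠ 0 ∨ t ≠ 0 := by
      by_contra! hst
      exact ne_zero_of_mem_Φ hxpos.1 (by simp [hst])
    filter_upwards [ha', hb'] with i hia hib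
    simp only [map_add, map_smul, smul_eq_mul]
    exact lex_pos_add hia hib hs ht hst
  · rintro a ⟨ha, ha'⟩ b ⟨hb, hb'⟩ x ⟨hx, hxpos⟩
    obtain ⟨s, t, hs, ht, rfl⟩ := mem_nnspan_pair.mp hx
    refine ⟨hxpos, fun hmem => ?_⟩
    have ha'' := Ultrafilter.eventually_not.mpr fun hev => ha' ⟨ha, hev⟩
    have hb'' := Ultrafilter.eventually_not.mpr fun hev => hb' ⟨hb, hev⟩
    obtain ⟨i, hia, hib, hi⟩ := (ha''.and (hb''.and hmem.2)).exists
    simp only [map_add, map_smul, smul_eq_mul] at hi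
    exact not_lex_pos_add hia hib hs ht hi

/-- If the functional `f₂ β • f₁ - f₁ β • f₂`, which vanishes at `β`, is eventually nonnegative
at `γ`, then it cuts out a biclosed set that separates `γ` from `β`. -/
lemma exists_isBiclosed_between {ι : Type*} (U : Ultrafilter ι) {R₁ R₂ : Set V}
    (hR₁ : R₁ ⊆ Φpos) (hR₂ : R₂ ⊆ Φpos) (hsub : R₁ ⊆ R₂) {f₁ f₂ : ι → V →ₗ[ℝ] ℝ}
    (h₁ : ∀ x ∈ R₁, ∀ᶠ i in U, 0 < f₁ i x) (h₁' : ∀ x ∈ Φpos \ R₁, ∀ᶠ i in U, f₁ i x < 0)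
    (h₂ : ∀ x ∈ R₂, ∀ᶠ i in U, 0 < f₂ i x) (h₂' : ∀ x ∈ Φpos \ R₂, ∀ᶠ i in U, f₂ i x < 0)
    {β γ : V} (hβ : β ∈ R₂ \ R₁) (hγ : γ ∈ R₂ \ R₁) (hne : γ ≠ β)
    (hβγ : ∀ᶠ i in U, 0 ≤ f₂ i β * f₁ i γ - f₁ i β * f₂ i γ) :
    ∃ R', IsBiclosed R' ∧ R₁ ⊂ R' ∧ R' ⊂ R₂ := by
  obtain ⟨k, hkβ, hkγ⟩ := exists_functional_separating (hR₂ hβ.1) (hR₂ hγ.1) hne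
  have hβ₁ := h₁' β ⟨hR₂ hβ.1, hβ.2⟩
  have hβ₂ := h₂ β hβ.1
  refine ⟨_, isBiclosed_lex U (fun i => f₂ i β • f₁ i - f₁ i β • f₂ i) k,
    Set.ssubset_iff_of_subset ?_ |>.mpr ⟨γ, ⟨hR₂ hγ.1, ?_⟩, hγ.2⟩,
    Set.ssubset_iff_of_subset ?_ |>.mpr ⟨β, hβ.1, ?_⟩⟩
  · intro x hx
    refine ⟨hR₁ hx, ?_⟩
    filter_upwards [hβ₁, hβ₂, h₁ x hx, h₂ x (hsub hx)] with i i₁ i₂ i₃ i₄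
    left
    simp only [LinearMap.sub_apply, LinearMap.smul_apply, smul_eq_mul]
    linarith [mul_pos i₂ i₃, mul_neg_of_neg_of_pos i₁ i₄]
  · filter_upwards [hβγ] with i hi
    simp only [LinearMap.sub_apply, LinearMap.smul_apply, smul_eq_mul]
    rcases hi.eq_or_lt with hi | hi
    · exact Or.inr ⟨hi.symm, hkγ⟩
    · exact Or.inl hi
  · rintro x ⟨hx, hpos⟩
    by_contra hxR
    obtain ⟨i, i₁, i₂, i₃, i₄, hi⟩ := (hβ₁.and (hβ₂.and ((h₁' x ⟨hx, fun h => hxR (hsub h)⟩).and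
      ((h₂' x ⟨hx, hxR⟩).and hpos)))).exists
    simp only [LinearMap.sub_apply, LinearMap.smul_apply, smul_eq_mul] at hi
    have := mul_neg_of_pos_of_neg i₂ i₃
    have := mul_pos_of_neg_of_neg i₁ i₄
    rcases hi with hi | hi <;> linarith
  · rintro ⟨_, hpos⟩
    obtain ⟨i, hi⟩ := hpos.exists
    simp [hkβ, mul_comm] at hi

/-- For biclosed sets `R₁ ⊆ R₂`, `R₂` covers `R₁` in the extended weak order iff
`R₂ \ R₁` consists of exactly one root. -/
theorem cover_iff_one_root (R₁ R₂ : Set V) (h₁ : IsBiclosed R₁) (h₂ : IsBiclosed R₂)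
    (hsub : R₁ ⊆ R₂) :
    (R₁ ⊂ R₂ ∧ ¬∃ R' : Set V, IsBiclosed R' ∧ R₁ ⊂ R' ∧ R' ⊂ R₂) ↔
      ∃ β : V, R₂ \ R₁ = {β} := by
  constructor
  · rintro ⟨hss, hno⟩
    obtain ⟨β, hβ⟩ := Set.nonempty_of_ssubset hss
    refine ⟨β, Set.eq_singleton_iff_unique_mem.mpr ⟨hβ, fun γ hγ => ?_⟩⟩
    by_contra hne
    obtain ⟨f₁, hf₁, hf₁'⟩ := h₁.exists_functionals
    obtain ⟨f₂, hf₂, hf₂'⟩ := h₂.exists_functionals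
    let U : Ultrafilter (Finset V) := Ultrafilter.of Filter.atTop
    have hU : (U : Filter (Finset V)) ≤ Filter.atTop := Ultrafilter.of_le _
    have between : ∀ b ∈ R₂ \ R₁, ∀ c ∈ R₂ \ R₁, c ≠ b →
        ¬∀ᶠ F in (U : Filter (Finset V)), 0 ≤ f₂ F b * f₁ F c - f₁ F b * f₂ F c :=
      fun b hb c hc hbc h => hno <| exists_isBiclosed_between U h₁.1 h₂.1 hsub
        (fun x hx => hU (hf₁ x hx)) (fun x hx => hU (hf₁' x hx))
        (fun x hx => hU (hf₂ x hx)) (fun x hx => hU (hf₂' x hx)) hb hc hbc h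
    have hβγ := Ultrafilter.eventually_not.mpr (between β hβ γ hγ hne)
    refine between γ hγ β hβ (Ne.symm hne) ?_
    filter_upwards [hβγ] with F hF
    push Not at hF
    linarith
  · rintro ⟨β, hβ⟩
    have hβmem : β ∈ R₂ \ R₁ := hβ ▸ Set.mem_singleton β
    refine ⟨Set.ssubset_iff_of_subset hsub |>.mpr ⟨β, hβmem⟩, ?_⟩
    rintro ⟨R', -, ⟨hsub₁, hnot₁⟩, ⟨hsub₂, hnot₂⟩⟩
    obtain ⟨x, hx, hx₁⟩ := Set.not_subset.mp hnot₁
    obtain ⟨y, hy, hy'⟩ := Set.not_subset.mp hnot₂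
    have ex : x = β := by simpa [hβ] using (show x ∈ R₂ \ R₁ from ⟨hsub₂ hx, hx₁⟩)
    have ey : y = β := by
      simpa [hβ] using (show y ∈ R₂ \ R₁ from ⟨hy, fun h => hy' (hsub₁ h)⟩)
    exact hy' (ey ▸ ex ▸ hx)
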